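/- arXiv:2004.09310 — 4 statements merged into one kernel-verified Lean document; each statement's English description precedes it below -/
import Mathlib

section
/- Let n ≥ 1, d ≥ 3, and let f_0,…,f_n ∈ S^{d-1} be a regular sequence of homogeneous polynomials of degree d−1 in S = ℂ[X_0,…,X_n]. Let R = S/(f_0,…,f_n), a graded ring with degree-k piece R^k, and set N = (n+1)(d−2). Let k ≤ k' be nonnegative integers with max(k, N−k') ≥ d−1 and N−k−k' > 0. Then the linear map R^{k'−k} → Hom_ℂ(R^k, R^{k'}) induced by ring multiplication is an isomorphism onto the subspace of 'symmetrizers' {h ∈ Hom_ℂ(R^k, R^{k'}) : b·h(a) = a·h(b) in R^{k+k'} for all a, b ∈ R^k}. -/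
open MvPolynomial

noncomputable section

abbrev S (n : ℕ) : Type := MvPolynomial (Fin (n + 1)) ℂ

/-- The Jacobian ideal of `f`, generated by its partial derivatives. -/
def jacobianIdeal {n : ℕ} (f : S n) : Ideal (S n) :=
  Ideal.span (Set.range fun i => MvPolynomial.pderiv i f)

/-- The degree-`k` graded piece of `S/I`: the image of the homogeneous degree-`k`
polynomials in the quotient. -/
def quotPiece {n : ℕ} (I : Ideal (S n)) (k : ℕ) : Submodule ℂ (S n ⧸ I) :=
  (MvPolynomial.homogeneousSubmodule (Fin (n + 1)) ℂ k).map
    (Ideal.Quotient.mkₐ ℂ I).toLinearMap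

/-- The degree-`k` graded piece `R_f^k` of the Jacobian ring `R_f = S/J_f`. -/
def Rpiece {n : ℕ} (f : S n) (k : ℕ) : Submodule ℂ (S n ⧸ jacobianIdeal f) :=
  quotPiece (jacobianIdeal f) k

/-- `f` defines a smooth hypersurface: its partial derivatives have no common
zero in `ℂ^{n+1} \ {0}`. -/
def SmoothHyp {n : ℕ} (f : S n) : Prop :=
  ∀ v : Fin (n + 1) → ℂ, (∀ i, MvPolynomial.eval v (MvPolynomial.pderiv i f) = 0) → v = 0

/-- A polynomial function on a complex vector space: an element of the algebra of
functions generated by the linear functionals. -/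
def IsPolyFun {M : Type} [AddCommGroup M] [Module ℂ M] (φ : M → ℂ) : Prop :=
  φ ∈ Algebra.adjoin ℂ {ψ : M → ℂ | ∃ l : M →ₗ[ℂ] ℂ, ψ = ⇑l}

/-- A property `P` holds for generic points of `M`: it holds on a nonempty
Zariski-open subset, i.e. on the nonvanishing locus of some polynomial function
that is not identically zero. -/
def GenericallyHolds {M : Type} [AddCommGroup M] [Module ℂ M] (P : M → Prop) : Prop :=
  ∃ φ : M → ℂ, IsPolyFun φ ∧ (∃ x, φ x ≠ 0) ∧ ∀ x, φ x ≠ 0 → P x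

/-- Substitution of the linear change of coordinates given by the matrix `A`. -/
def substLin {n : ℕ} (A : Matrix (Fin (n + 1)) (Fin (n + 1)) ℂ) (f : S n) : S n :=
  MvPolynomial.aeval (fun i => ∑ j, A i j • MvPolynomial.X j) f

/-- A regular sequence: each `f i` is a nonzerodivisor modulo the previous ones. -/
def IsRegularSeq {n c : ℕ} (f : Fin c → S n) : Prop :=
  ∀ (i : Fin c) (g : S n),
    f i * g ∈ Ideal.span (f '' {j | j < i}) → g ∈ Ideal.span (f '' {j | j < i})

/-- Zariski-closed subset of a complex vector space: common zero locus of a set of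
polynomial functions. -/
def IsZariskiClosed {M : Type} [AddCommGroup M] [Module ℂ M] (T : Set M) : Prop :=
  ∃ 𝒮 : Set (M → ℂ), (∀ φ ∈ 𝒮, IsPolyFun φ) ∧ T = {x | ∀ φ ∈ 𝒮, φ x = 0}

/-- An irreducible Zariski-closed subset. -/
def IsIrredClosed {M : Type} [AddCommGroup M] [Module ℂ M] (Z : Set M) : Prop :=
  IsZariskiClosed Z ∧ Z.Nonempty ∧
    ∀ C₁ C₂ : Set M, IsZariskiClosed C₁ → IsZariskiClosed C₂ →
      Z ⊆ C₁ ∪ C₂ → Z ⊆ C₁ ∨ Z ⊆ C₂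

/-- The (Krull) dimension of the algebraic set `T` is at least `m`: there is a strictly
increasing chain of `m+1` irreducible closed subsets contained in `T`. -/
def algDimGE {M : Type} [AddCommGroup M] [Module ℂ M] (T : Set M) (m : ℕ) : Prop :=
  ∃ Z : Fin (m + 1) → Set M, StrictMono Z ∧ (∀ i, IsIrredClosed (Z i)) ∧
    Z (Fin.last m) ⊆ T

section GradedIdeals

variable {n : ℕ}

/-- `g` is a nonzerodivisor modulo the ideal `J`. -/
def IsRegularMod (J : Ideal (S n)) (g : S n) : Prop :=
  ∀ p, g * p ∈ J → p ∈ J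

/-- `J` contains the homogeneous components of its elements. -/
def IsGradedIdeal (J : Ideal (S n)) : Prop :=
  ∀ p ∈ J, ∀ i, homogeneousComponent i p ∈ J

theorem mem_of_forall_homogeneousComponent_mem {J : Ideal (S n)} {p : S n}
    (h : ∀ i, homogeneousComponent i p ∈ J) : p ∈ J := by
  rw [← sum_homogeneousComponent p]
  exact J.sum_mem fun i _ => h i

theorem isGradedIdeal_bot : IsGradedIdeal (⊥ : Ideal (S n)) := by
  intro p hp i
  rw [Ideal.mem_bot] at hp
  simp [hp]

theorem homogeneousComponent_mul_of_isHomogeneous {f : S n} {D : ℕ} (hf : f.IsHomogeneous D)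
    (g : S n) (t : ℕ) :
    homogeneousComponent (D + t) (f * g) = f * homogeneousComponent t g := by
  induction g using MvPolynomial.induction_on' with
  | monomial m a =>
    have hm := isHomogeneous_monomial (σ := Fin (n + 1)) a (rfl : m.degree = m.degree)
    rw [homogeneousComponent_of_mem (hf.mul hm), homogeneousComponent_of_mem hm]
    simp
  | add p q hp hq => simp only [mul_add, map_add, hp, hq]

theorem homogeneousComponent_mul_eq_zero {f : S n} {D : ℕ} (hf : f.IsHomogeneous D)
    (g : S n) {t : ℕ} (ht : t < D) :
    homogeneousComponent t (f * g) = 0 := by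
  induction g using MvPolynomial.induction_on' with
  | monomial m a =>
    have hm := isHomogeneous_monomial (σ := Fin (n + 1)) a (rfl : m.degree = m.degree)
    rw [homogeneousComponent_of_mem (hf.mul hm), if_neg (by omega)]
  | add p q hp hq => simp only [mul_add, map_add, hp, hq, add_zero]

theorem mem_sup_span_singleton {J : Ideal (S n)} {f c : S n} :
    c ∈ J ⊔ Ideal.span {f} ↔ ∃ p, c - f * p ∈ J := by
  rw [Submodule.mem_sup]
  constructor
  · rintro ⟨a, ha, b, hb, rfl⟩
    obtain ⟨p, rfl⟩ := Ideal.mem_span_singleton'.1 hb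
    exact ⟨p, by simpa [mul_comm] using ha⟩
  · rintro ⟨p, hp⟩
    exact ⟨_, hp, f * p, Ideal.mul_mem_right _ _ (Ideal.mem_span_singleton_self f), by ring⟩

theorem IsGradedIdeal.exists_isHomogeneous {J : Ideal (S n)} (hJ : IsGradedIdeal J) {f c : S n}
    {D t : ℕ} (hf : f.IsHomogeneous D) (hc : c.IsHomogeneous (D + t))
    (h : c ∈ J ⊔ Ideal.span {f}) : ∃ p : S n, p.IsHomogeneous t ∧ c - f * p ∈ J := by
  obtain ⟨p, hp⟩ := mem_sup_span_singleton.1 h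
  refine ⟨_, homogeneousComponent_isHomogeneous t p, ?_⟩
  have := hJ _ hp (D + t)
  rwa [map_sub, homogeneousComponent_eq_self hc,
    homogeneousComponent_mul_of_isHomogeneous hf] at this

theorem IsGradedIdeal.mem_of_lt {J : Ideal (S n)} (hJ : IsGradedIdeal J) {f c : S n}
    {D t : ℕ} (hf : f.IsHomogeneous D) (hc : c.IsHomogeneous t) (ht : t < D)
    (h : c ∈ J ⊔ Ideal.span {f}) : c ∈ J := by
  obtain ⟨p, hp⟩ := mem_sup_span_singleton.1 h
  have := hJ _ hp t
  rwa [map_sub, homogeneousComponent_eq_self hc, homogeneousComponent_mul_eq_zero hf _ ht,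
    sub_zero] at this

theorem IsGradedIdeal.sup_span_singleton {J : Ideal (S n)} (hJ : IsGradedIdeal J) {f : S n}
    {D : ℕ} (hf : f.IsHomogeneous D) : IsGradedIdeal (J ⊔ Ideal.span {f}) := by
  intro c hc i
  obtain ⟨p, hp⟩ := mem_sup_span_singleton.1 hc
  have h := hJ _ hp i
  rw [map_sub] at h
  rcases lt_or_ge i D with hi | hi
  · rw [homogeneousComponent_mul_eq_zero hf _ hi, sub_zero] at h
    exact Ideal.mem_sup_left h
  · obtain ⟨t, rfl⟩ := Nat.exists_eq_add_of_le hi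
    rw [homogeneousComponent_mul_of_isHomogeneous hf] at h
    exact mem_sup_span_singleton.2 ⟨_, h⟩

theorem IsRegularMod.of_sup {J : Ideal (S n)} (hJ : IsGradedIdeal J) {f g : S n} {D : ℕ}
    (hD : 0 < D) (hf : f.IsHomogeneous D) (hfJ : IsRegularMod J f)
    (hg : IsRegularMod (J ⊔ Ideal.span {f}) g) : IsRegularMod J g := by
  intro m hm
  have key : ∀ k : ℕ, ∃ p, m - f ^ k * p ∈ J ∧ g * p ∈ J := by
    intro k
    induction k with
    | zero => exact ⟨m, by simp, hm⟩
    | succ k ih =>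
      obtain ⟨p, hp, hgp⟩ := ih
      obtain ⟨q, hq⟩ := mem_sup_span_singleton.1 (hg p (Ideal.mem_sup_left hgp))
      refine ⟨q, ?_, hfJ _ ?_⟩
      · have := J.add_mem hp (J.mul_mem_left (f ^ k) hq)
        convert this using 1
        ring
      · have := J.sub_mem hgp (J.mul_mem_left g hq)
        convert this using 1
        ring
  refine mem_of_forall_homogeneousComponent_mem fun i => ?_
  obtain ⟨p, hp, -⟩ := key (i + 1)
  have h := hJ _ hp i
  rwa [map_sub, homogeneousComponent_mul_eq_zero (hf.pow (i + 1)) _ (by nlinarith),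
    sub_zero] at h

theorem IsRegularMod.sup_of_sup {J : Ideal (S n)} {f g : S n} (hfJ : IsRegularMod J f)
    (hg : IsRegularMod (J ⊔ Ideal.span {f}) g) :
    IsRegularMod (J ⊔ Ideal.span {g}) f := by
  intro m hm
  obtain ⟨p, hp⟩ := mem_sup_span_singleton.1 hm
  have hp' : p ∈ J ⊔ Ideal.span {f} := by
    refine hg _ (mem_sup_span_singleton.2 ⟨m, ?_⟩)
    rw [← neg_sub]
    exact J.neg_mem hp
  obtain ⟨q, hq⟩ := mem_sup_span_singleton.1 hp'
  refine mem_sup_span_singleton.2 ⟨q, hfJ _ ?_⟩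
  have := J.add_mem hp (J.mul_mem_left g hq)
  convert this using 1
  ring

/-- Each member of the list is a nonzerodivisor modulo `J` and the previous members. -/
def IsRegularOver : Ideal (S n) → List (S n) → Prop
  | _, [] => True
  | J, f :: l => IsRegularMod J f ∧ IsRegularOver (J ⊔ Ideal.span {f}) l

theorem isRegularOver_concat {l : List (S n)} {J : Ideal (S n)} {g : S n} :
    IsRegularOver J (l ++ [g]) ↔ IsRegularOver J l ∧ IsRegularMod (J ⊔ Ideal.ofList l) g := by
  induction l generalizing J with
  | nil => simp [IsRegularOver]
  | cons f l ih => simp [IsRegularOver, ih, and_assoc, Ideal.ofList_cons, sup_assoc]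

theorem IsGradedIdeal.sup_ofList {l : List (S n)} {J : Ideal (S n)} (hJ : IsGradedIdeal J) {D : ℕ}
    (hl : ∀ f ∈ l, f.IsHomogeneous D) : IsGradedIdeal (J ⊔ Ideal.ofList l) := by
  induction l generalizing J with
  | nil => simpa using hJ
  | cons f l ih =>
    rw [Ideal.ofList_cons, ← sup_assoc]
    exact ih (hJ.sup_span_singleton (hl f (by simp))) fun g hg => hl g (by simp [hg])

theorem IsRegularOver.rotate {l : List (S n)} {J : Ideal (S n)} {g : S n} (hJ : IsGradedIdeal J)
    {D : ℕ} (hD : 0 < D) (hl : ∀ f ∈ l, f.IsHomogeneous D) (h : IsRegularOver J (l ++ [g])) :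
    IsRegularOver J (g :: l) := by
  induction l generalizing J with
  | nil => exact h
  | cons f l ih =>
    have hf := hl f (by simp)
    obtain ⟨hfg, hfgl⟩ := ih (hJ.sup_span_singleton hf) (fun p hp => hl p (by simp [hp])) h.2
    have hg := h.1.of_sup hJ hD hf hfg
    refine ⟨hg, h.1.sup_of_sup hfg, ?_⟩
    rwa [sup_right_comm]

theorem mem_of_forall_monomial_mem {M : Submodule ℂ (S n)} {t : ℕ}
    (h : ∀ m : Fin (n + 1) →₀ ℕ, m.degree = t → monomial m 1 ∈ M) {p : S n}
    (hp : p.IsHomogeneous t) : p ∈ M := by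
  rw [p.as_sum]
  refine M.sum_mem fun m hm => ?_
  have hmt : m.degree = t := by
    by_contra hne
    exact (mem_support_iff.1 hm) (hp.coeff_eq_zero hne)
  have := M.smul_mem (coeff m p) (h m hmt)
  rwa [smul_monomial, smul_eq_mul, mul_one] at this

theorem mem_of_forall_X_mem {P : Ideal (S n)} (hP : ∀ i, (X i : S n) ∈ P) {t : ℕ} (ht : 0 < t)
    {p : S n} (hp : p.IsHomogeneous t) : p ∈ P := by
  refine mem_of_forall_monomial_mem (M := P.restrictScalars ℂ) (fun m hm => ?_) hp
  obtain ⟨i, hi⟩ : ∃ i, m i ≠ 0 := by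
    by_contra! h
    have : m = 0 := Finsupp.ext h
    simp [this] at hm
    omega
  have hle : Finsupp.single i 1 ≤ m := by
    rw [Finsupp.single_le_iff]
    omega
  have hmul : (monomial m 1 : S n) = monomial (m - Finsupp.single i 1) 1 * X i := by
    rw [X, monomial_mul, tsub_add_cancel_of_le hle, mul_one]
  rw [Submodule.restrictScalars_mem, hmul]
  exact P.mul_mem_left _ (hP i)

/-- Prime avoidance: a linear form is regular modulo `J` as soon as some form of positive
degree is. -/
theorem exists_linear_isRegularMod {J : Ideal (S n)} {f : S n} {D : ℕ} (hD : 0 < D)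
    (hf : f.IsHomogeneous D) (hfJ : IsRegularMod J f) :
    ∃ l : S n, l.IsHomogeneous 1 ∧ IsRegularMod J l := by
  let A := S n ⧸ J
  have hfin : (associatedPrimes A A).Finite := associatedPrimes.finite A A
  let U : Ideal A → Subspace ℂ (homogeneousSubmodule (Fin (n + 1)) ℂ 1) := fun P =>
    (P.restrictScalars ℂ).comap
      ((Ideal.Quotient.mkₐ ℂ J).toLinearMap ∘ₗ (homogeneousSubmodule (Fin (n + 1)) ℂ 1).subtype)
  have hzd := biUnion_associatedPrimes_eq_zero_divisors A A
  classical
  have hU : ⊤ ∉ hfin.toFinset.image U := by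
    intro h
    obtain ⟨P, hP, hPU⟩ := Finset.mem_image.1 h
    have hX : ∀ i, (X i : S n) ∈ P.comap (Ideal.Quotient.mk J) := by
      intro i
      have : (⟨X i, isHomogeneous_X ℂ i⟩ : homogeneousSubmodule (Fin (n + 1)) ℂ 1) ∈ U P := by
        rw [hPU]
        trivial
      exact this
    have hfP : Ideal.Quotient.mk J f ∈ P := mem_of_forall_X_mem hX hD hf
    have : Ideal.Quotient.mk J f ∈ ⋃ p ∈ associatedPrimes A A, (p : Set A) :=
      Set.mem_biUnion (hfin.mem_toFinset.1 hP) hfP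
    rw [hzd] at this
    obtain ⟨x, hx0, hx⟩ := this
    obtain ⟨p, rfl⟩ := Ideal.Quotient.mk_surjective x
    rw [smul_eq_mul, ← map_mul, Ideal.Quotient.eq_zero_iff_mem] at hx
    exact hx0 (Ideal.Quotient.eq_zero_iff_mem.2 (hfJ p hx))
  have hne := Subspace.biUnion_ne_univ_of_top_notMem hU
  obtain ⟨l, hl⟩ := (Set.ne_univ_iff_exists_notMem _).1 hne
  refine ⟨l, l.2, fun p hp => ?_⟩
  by_contra hpJ
  have : Ideal.Quotient.mk J l ∈ ⋃ p ∈ associatedPrimes A A, (p : Set A) := by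
    rw [hzd]
    refine ⟨Ideal.Quotient.mk J p, fun h => hpJ (Ideal.Quotient.eq_zero_iff_mem.1 h), ?_⟩
    rw [smul_eq_mul, ← map_mul]
    exact Ideal.Quotient.eq_zero_iff_mem.2 hp
  obtain ⟨P, hP, hlP⟩ := Set.mem_iUnion₂.1 this
  refine hl (Set.mem_iUnion₂.2 ⟨U P, Finset.mem_image_of_mem U (hfin.mem_toFinset.2 hP), ?_⟩)
  exact hlP

end GradedIdeals

section SocleDegree

variable {n : ℕ}

theorem mem_quotPiece {I : Ideal (S n)} {k : ℕ} {x : S n ⧸ I} :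
    x ∈ quotPiece I k ↔ ∃ p : S n, p.IsHomogeneous k ∧ Ideal.Quotient.mk I p = x :=
  Iff.rfl

theorem mk_mem_quotPiece (I : Ideal (S n)) {k : ℕ} {p : S n} (hp : p.IsHomogeneous k) :
    Ideal.Quotient.mk I p ∈ quotPiece I k :=
  mem_quotPiece.2 ⟨p, hp, rfl⟩

theorem mul_mem_quotPiece {I : Ideal (S n)} {j k : ℕ} {x y : S n ⧸ I} (hx : x ∈ quotPiece I j)
    (hy : y ∈ quotPiece I k) : x * y ∈ quotPiece I (j + k) := by
  obtain ⟨p, hp, rfl⟩ := mem_quotPiece.1 hx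
  obtain ⟨q, hq, rfl⟩ := mem_quotPiece.1 hy
  rw [← map_mul]
  exact mk_mem_quotPiece I (hp.mul hq)

instance finiteDimensional_quotPiece (I : Ideal (S n)) (k : ℕ) :
    FiniteDimensional ℂ (quotPiece I k) :=
  Module.Finite.iff_fg.2 ((homogeneousSubmodule_fg _ _ k).map _)

/-- The graded quotient of the polynomial ring by `J` vanishes above degree `e`, is at most
one-dimensional in degree `e`, and has no socle below degree `e`. -/
structure SocleDegree (J : Ideal (S n)) (e : ℕ) : Prop where
  mem_of_socle : ∀ j < e, ∀ c : S n, c.IsHomogeneous j → (∀ i, X i * c ∈ J) → c ∈ J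
  mem_of_lt : ∀ j > e, ∀ c : S n, c.IsHomogeneous j → c ∈ J
  dependent : ∀ c₁ c₂ : S n, c₁.IsHomogeneous e → c₂.IsHomogeneous e →
    ∃ α β : ℂ, (α ≠ 0 ∨ β ≠ 0) ∧ α • c₁ + β • c₂ ∈ J

theorem socleDegree_zero {J : Ideal (S n)} (hJ : ∀ i, (X i : S n) ∈ J) : SocleDegree J 0 where
  mem_of_socle := by simp
  mem_of_lt _ hj _ hc := mem_of_forall_X_mem hJ hj hc
  dependent c₁ c₂ h₁ h₂ := by
    rw [← totalDegree_zero_iff_isHomogeneous, totalDegree_eq_zero_iff_eq_C] at h₁ h₂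
    by_cases h : coeff 0 c₁ = 0
    · refine ⟨1, 0, by simp, ?_⟩
      rw [h₁, h]
      simp
    · refine ⟨coeff 0 c₂, -coeff 0 c₁, by simp [h], ?_⟩
      rw [h₁, h₂]
      simp [smul_eq_C_mul, mul_comm]

theorem injective_mulLeft_of_isRegularMod {J : Ideal (S n)} {f : S n} (hf : IsRegularMod J f) :
    Function.Injective (LinearMap.mulLeft ℂ (Ideal.Quotient.mk J f)) := by
  rw [injective_iff_map_eq_zero]
  intro x hx
  obtain ⟨p, rfl⟩ := Ideal.Quotient.mk_surjective x
  rw [LinearMap.mulLeft_apply, ← map_mul, Ideal.Quotient.eq_zero_iff_mem] at hx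
  exact Ideal.Quotient.eq_zero_iff_mem.2 (hf p hx)

theorem map_mulLeft_quotPiece_le (J : Ideal (S n)) {f : S n} {D : ℕ} (hf : f.IsHomogeneous D)
    (t : ℕ) :
    (quotPiece J t).map (LinearMap.mulLeft ℂ (Ideal.Quotient.mk J f)) ≤ quotPiece J (D + t) := by
  rintro _ ⟨x, hx, rfl⟩
  exact mul_mem_quotPiece (mk_mem_quotPiece J hf) hx

/-- If the quotient by a linear nonzerodivisor vanishes above degree `e`, then the dimensions of
the graded pieces are eventually nonincreasing. -/
theorem finrank_quotPiece_add_le {J : Ideal (S n)} (hJ : IsGradedIdeal J) {l : S n}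
    (hl : l.IsHomogeneous 1) {e : ℕ}
    (h : ∀ j > e, ∀ c : S n, c.IsHomogeneous j → c ∈ J ⊔ Ideal.span {l}) {t : ℕ} (ht : e ≤ t)
    (D : ℕ) :
    Module.finrank ℂ (quotPiece J (D + t)) ≤ Module.finrank ℂ (quotPiece J t) := by
  induction D with
  | zero => rw [zero_add]
  | succ D ih =>
    refine le_trans ?_ ih
    have hle : quotPiece J (D + 1 + t) ≤
        (quotPiece J (D + t)).map (LinearMap.mulLeft ℂ (Ideal.Quotient.mk J l)) := by
      intro x hx
      obtain ⟨p, hp, rfl⟩ := mem_quotPiece.1 hx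
      rw [show D + 1 + t = 1 + (D + t) by ring] at hp
      obtain ⟨q, hq, hpq⟩ := hJ.exists_isHomogeneous hl hp (h _ (by omega) p hp)
      refine ⟨_, mk_mem_quotPiece J hq, ?_⟩
      rw [LinearMap.mulLeft_apply, ← map_mul]
      exact (Ideal.Quotient.eq.2 hpq).symm
    exact (Submodule.finrank_mono hle).trans (Submodule.finrank_map_le _ _)

theorem SocleDegree.exchange {J : Ideal (S n)} (hJ : IsGradedIdeal J) {l f : S n} {r e : ℕ}
    (hl : l.IsHomogeneous 1) (hf : f.IsHomogeneous (r + 1)) (hlJ : IsRegularMod J l)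
    (hfJ : IsRegularMod J f) (h : SocleDegree (J ⊔ Ideal.span {l}) e) :
    SocleDegree (J ⊔ Ideal.span {f}) (e + r) := by
  have cancel : ∀ c c' q : S n, l * c - f * c' ∈ J → c' - l * q ∈ J →
      c ∈ J ⊔ Ideal.span {f} := by
    intro c c' q h₁ h₂
    refine mem_sup_span_singleton.2 ⟨q, hlJ _ ?_⟩
    have := J.add_mem h₁ (J.mul_mem_left f h₂)
    convert this using 1
    ring
  have mul_mem_of_X : ∀ c : S n, (∀ i, X i * c ∈ J ⊔ Ideal.span {f}) →
      l * c ∈ J ⊔ Ideal.span {f} := by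
    intro c hc
    have := mem_of_forall_X_mem (P := Submodule.colon (J ⊔ Ideal.span {f}) {c})
      (fun i => Submodule.mem_colon_singleton.2 (hc i)) one_pos hl
    exact Submodule.mem_colon_singleton.1 this
  have top : ∀ j > e + r, ∀ c : S n, c.IsHomogeneous j → c ∈ J ⊔ Ideal.span {f} := by
    intro j hj c hc
    obtain ⟨t, rfl⟩ : ∃ t, j = (r + 1) + t := ⟨j - (r + 1), by omega⟩
    have heq := Submodule.eq_of_le_of_finrank_le (map_mulLeft_quotPiece_le J hf t) (by
      rw [← (Submodule.equivMapOfInjective _ (injective_mulLeft_of_isRegularMod hfJ) _).finrank_eq]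
      exact finrank_quotPiece_add_le hJ hl h.mem_of_lt (by omega) _)
    have hcm := mk_mem_quotPiece J hc
    rw [← heq] at hcm
    obtain ⟨x, hx, hxc⟩ := hcm
    obtain ⟨p, hp, rfl⟩ := mem_quotPiece.1 hx
    rw [LinearMap.mulLeft_apply, ← map_mul] at hxc
    exact mem_sup_span_singleton.2 ⟨p, Ideal.Quotient.eq.1 hxc.symm⟩
  refine ⟨fun j hj c hc hX => ?_, top, fun c₁ c₂ h₁ h₂ => ?_⟩
  · have hlc := mul_mem_of_X c hX
    rcases lt_or_ge j r with hjr | hjr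
    · exact Ideal.mem_sup_left
        (hlJ c (hJ.mem_of_lt hf (hl.mul hc) (by omega) hlc))
    · obtain ⟨t, rfl⟩ := Nat.exists_eq_add_of_le hjr
      obtain ⟨c', hc', hcc'⟩ := hJ.exists_isHomogeneous (t := t) hf
        (by convert hl.mul hc using 1; ring) hlc
      have hmem : c' ∈ J ⊔ Ideal.span {l} := by
        refine h.mem_of_socle t (by omega) c' hc' fun i => ?_
        obtain ⟨p, hp⟩ := mem_sup_span_singleton.1 (hX i)
        refine mem_sup_span_singleton.2 ⟨p, hfJ _ ?_⟩
        have := J.sub_mem (J.mul_mem_left l hp) (J.mul_mem_left (X i) hcc')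
        convert this using 1
        ring
      obtain ⟨q, hq⟩ := mem_sup_span_singleton.1 hmem
      exact cancel c c' q hcc' hq
  · have lift : ∀ c : S n, c.IsHomogeneous (e + r) →
        ∃ c' : S n, c'.IsHomogeneous e ∧ l * c - f * c' ∈ J := fun c hc =>
      hJ.exists_isHomogeneous hf (by convert hl.mul hc using 1; ring)
        (top (1 + (e + r)) (by omega) _ (hl.mul hc))
    obtain ⟨c₁', h₁', hc₁⟩ := lift c₁ h₁
    obtain ⟨c₂', h₂', hc₂⟩ := lift c₂ h₂
    obtain ⟨α, β, hαβ, hmem⟩ := h.dependent c₁' c₂' h₁' h₂'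
    obtain ⟨q, hq⟩ := mem_sup_span_singleton.1 hmem
    refine ⟨α, β, hαβ, cancel _ _ q ?_ hq⟩
    have := J.add_mem (J.mul_mem_left (C α) hc₁) (J.mul_mem_left (C β) hc₂)
    convert this using 1
    simp only [smul_eq_C_mul]
    ring

theorem socleDegree_ofList {r : ℕ} (F : List (S n)) {J : Ideal (S n)} (hJ : IsGradedIdeal J)
    (h1 : (1 : S n) ∉ J) (hF : ∀ f ∈ F, f.IsHomogeneous (r + 1)) (hreg : IsRegularOver J F)
    (W : Submodule ℂ (S n)) (hW : W ≤ homogeneousSubmodule _ ℂ 1)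
    (hWJ : ∀ w ∈ W, w ∈ J) (hrank : n + 1 ≤ Module.finrank ℂ W + F.length) :
    SocleDegree (J ⊔ Ideal.ofList F) (F.length * r) := by
  have : FiniteDimensional ℂ (homogeneousSubmodule (Fin (n + 1)) ℂ 1) :=
    Module.Finite.iff_fg.2 (homogeneousSubmodule_fg _ _ 1)
  induction hlen : F.length generalizing F J W with
  | zero =>
    obtain rfl := List.eq_nil_of_length_eq_zero hlen
    have hle : Module.finrank ℂ (homogeneousSubmodule (Fin (n + 1)) ℂ 1) ≤ n + 1 := by
      rw [homogeneousSubmodule_one_eq_span_X]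
      exact (finrank_range_le_card (R := ℂ) (X : Fin (n + 1) → S n)).trans (by simp)
    have hWeq := Submodule.eq_of_le_of_finrank_le hW (hle.trans (by simpa using hrank))
    have hX : ∀ i, (X i : S n) ∈ J := fun i => hWJ _ (hWeq ▸ isHomogeneous_X ℂ i)
    simpa using socleDegree_zero hX
  | succ k ih =>
    obtain ⟨F', f, rfl⟩ := (List.eq_nil_or_concat' F).resolve_left (by rintro rfl; simp at hlen)
    have hlen' : F'.length = k := by simpa using hlen
    have hF' : ∀ g ∈ F', g.IsHomogeneous (r + 1) := fun g hg => hF g (by simp [hg])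
    have hf := hF f (by simp)
    obtain ⟨hregF', hregf⟩ := isRegularOver_concat.1 hreg
    obtain ⟨l, hl, hlreg⟩ := exists_linear_isRegularMod (Nat.succ_pos r) hf hregf
    obtain ⟨hlJ, hregl⟩ := IsRegularOver.rotate hJ (Nat.succ_pos r) hF'
      (isRegularOver_concat.2 ⟨hregF', hlreg⟩)
    have hlW : l ∉ W := fun h => h1 (hlJ 1 (by simpa using hWJ l h))
    have hstep := ih F' (J := J ⊔ Ideal.span {l}) (hJ.sup_span_singleton hl)
      (fun h => h1 (hJ.mem_of_lt hl (isHomogeneous_one _ _) one_pos h)) hF' hregl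
      (W ⊔ Submodule.span ℂ {l})
      (sup_le hW (by simpa [Submodule.span_le] using hl))
      (by
        intro w hw
        obtain ⟨a, ha, b, hb, rfl⟩ := Submodule.mem_sup.1 hw
        obtain ⟨α, rfl⟩ := Submodule.mem_span_singleton.1 hb
        refine Ideal.add_mem _ (Ideal.mem_sup_left (hWJ a ha)) (Ideal.mem_sup_right ?_)
        rw [smul_eq_C_mul]
        exact Ideal.mul_mem_left _ _ (Ideal.mem_span_singleton_self l))
      (by
        have : FiniteDimensional ℂ W := Submodule.finiteDimensional_of_le hW
        have hlt : W < W ⊔ Submodule.span ℂ {l} :=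
          lt_of_le_of_ne le_sup_left fun h => hlW (h ▸ Submodule.mem_sup_right
            (Submodule.mem_span_singleton_self l))
        have := Submodule.finrank_lt_finrank_of_lt hlt
        simp only [List.length_append, List.length_singleton] at hrank
        omega) hlen'
    rw [sup_right_comm] at hstep
    rw [Ideal.ofList_append, Ideal.ofList_singleton, ← sup_assoc, Nat.succ_mul]
    exact hstep.exchange (hJ.sup_ofList hF') hl hf hlreg hregf

theorem isRegularOver_ofFn_take {f : Fin (n + 1) → S n} (hreg : IsRegularSeq f) (m : ℕ) :
    IsRegularOver ⊥ ((List.ofFn f).take m) := by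
  induction m with
  | zero => simp [IsRegularOver]
  | succ m ih =>
    rcases lt_or_ge m (n + 1) with hm | hm
    · rw [List.take_succ_eq_append_getElem (by simpa using hm), isRegularOver_concat]
      refine ⟨ih, ?_⟩
      have heq : {x | x ∈ (List.ofFn f).take m} = f '' {j | j < ⟨m, hm⟩} := by
        ext x
        simp only [Set.mem_ofPred_eq, List.mem_take_iff_getElem, List.length_ofFn,
          List.getElem_ofFn, Set.mem_image, Fin.lt_def]
        constructor
        · rintro ⟨i, hi, rfl⟩
          exact ⟨⟨i, by omega⟩, by simpa using by omega, rfl⟩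
        · rintro ⟨i, hi, rfl⟩
          exact ⟨i, by omega, rfl⟩
      rw [bot_sup_eq, Ideal.ofList, heq, List.getElem_ofFn]
      exact hreg ⟨m, hm⟩
    · rw [List.take_of_length_le (by rw [List.length_ofFn]; omega)] at ih ⊢
      exact ih

/-- **Macaulay's theorem**, without the nonvanishing of the socle. -/
theorem socleDegree_of_isRegularSeq {f : Fin (n + 1) → S n} {r : ℕ}
    (hf : ∀ i, (f i).IsHomogeneous (r + 1)) (hreg : IsRegularSeq f) :
    SocleDegree (Ideal.span (Set.range f)) ((n + 1) * r) := by
  have hF := isRegularOver_ofFn_take hreg (n + 1)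
  rw [List.take_of_length_le (by simp)] at hF
  have := socleDegree_ofList (r := r) (List.ofFn f) isGradedIdeal_bot (by simp)
    (List.forall_mem_ofFn_iff.2 hf) hF ⊥ bot_le (by simp) (by simp)
  have heq : {x | x ∈ List.ofFn f} = Set.range f := by
    ext x
    exact List.mem_ofFn' f x
  rwa [bot_sup_eq, Ideal.ofList, heq, List.length_ofFn] at this

end SocleDegree

section Symmetrizers

variable {n : ℕ}

theorem SocleDegree.eq_zero_of_forall_mul {I : Ideal (S n)} {N : ℕ} (hI : SocleDegree I N)
    {j t : ℕ} (hjt : j + t ≤ N) {y : S n ⧸ I} (hy : y ∈ quotPiece I j)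
    (h : ∀ u : S n, u.IsHomogeneous t → Ideal.Quotient.mk I u * y = 0) : y = 0 := by
  induction t generalizing j y with
  | zero => simpa using h 1 (isHomogeneous_one _ _)
  | succ t ih =>
    obtain ⟨c, hc, rfl⟩ := mem_quotPiece.1 hy
    refine Ideal.Quotient.eq_zero_iff_mem.2 (hI.mem_of_socle j (by omega) c hc fun i => ?_)
    refine Ideal.Quotient.eq_zero_iff_mem.1 (ih (j := 1 + j) (by omega)
      (mk_mem_quotPiece I ((isHomogeneous_X ℂ i).mul hc)) fun u hu => ?_)
    rw [map_mul, ← mul_assoc, ← map_mul]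
    exact h _ (hu.mul (isHomogeneous_X ℂ i))

theorem SocleDegree.exists_functional {I : Ideal (S n)} {N : ℕ} (hI : SocleDegree I N) :
    ∃ ε : S n ⧸ I →ₗ[ℂ] ℂ, ∀ y ∈ quotPiece I N, ε y = 0 → y = 0 := by
  by_cases hzero : ∀ y ∈ quotPiece I N, y = 0
  · exact ⟨0, fun y hy _ => hzero y hy⟩
  push Not at hzero
  obtain ⟨x, hx, hx0⟩ := hzero
  obtain ⟨ε, hε⟩ : ∃ ε : Module.Dual ℂ (S n ⧸ I), ε x ≠ 0 := by
    by_contra! h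
    exact hx0 ((Module.forall_dual_apply_eq_zero_iff ℂ x).1 h)
  refine ⟨ε, fun y hy hεy => ?_⟩
  obtain ⟨p, hp, rfl⟩ := mem_quotPiece.1 hx
  obtain ⟨q, hq, rfl⟩ := mem_quotPiece.1 hy
  obtain ⟨α, β, hαβ, hmem⟩ := hI.dependent p q hp hq
  have hrel : α • Ideal.Quotient.mk I p + β • Ideal.Quotient.mk I q = 0 :=
    Ideal.Quotient.eq_zero_iff_mem.2 hmem
  have hα : α = 0 := by
    have := congrArg ε hrel
    simpa [hεy, hε] using this
  have hβ : β ≠ 0 := hαβ.resolve_left (not_not.2 hα)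
  simpa [hα, hβ] using hrel

/-- Multiplication followed by a functional that is injective on the top piece is a perfect
pairing between graded pieces of complementary degree. -/
theorem SocleDegree.exists_eq_functional_mul {I : Ideal (S n)} {N : ℕ} (hI : SocleDegree I N)
    {ε : S n ⧸ I →ₗ[ℂ] ℂ} (hε : ∀ y ∈ quotPiece I N, ε y = 0 → y = 0) {i j : ℕ} (hij : i + j = N)
    (φ : quotPiece I j →ₗ[ℂ] ℂ) :
    ∃ c ∈ quotPiece I i, ∀ x : quotPiece I j, φ x = ε (c * x) := by
  let B : quotPiece I i →ₗ[ℂ] quotPiece I j →ₗ[ℂ] ℂ :=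
    ((LinearMap.mul ℂ (S n ⧸ I)).compr₂ ε).compl₁₂ (quotPiece I i).subtype (quotPiece I j).subtype
  have hB : ∀ x y, B x y = ε (x * y) := fun _ _ => rfl
  have hinj : Function.Injective B := by
    rw [injective_iff_map_eq_zero]
    intro x hx
    refine Subtype.ext (hI.eq_zero_of_forall_mul hij.le x.2 fun u hu => ?_)
    refine hε _ ?_ ?_
    · rw [← hij, add_comm i j]
      exact mul_mem_quotPiece (mk_mem_quotPiece I hu) x.2
    · rw [mul_comm]
      exact LinearMap.congr_fun hx ⟨_, mk_mem_quotPiece I hu⟩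
  have hinj' : Function.Injective B.flip := by
    rw [injective_iff_map_eq_zero]
    intro x hx
    refine Subtype.ext (hI.eq_zero_of_forall_mul (t := i) (by omega) x.2 fun u hu => ?_)
    refine hε _ ?_ ?_
    · rw [← hij]
      exact mul_mem_quotPiece (mk_mem_quotPiece I hu) x.2
    · exact LinearMap.congr_fun hx ⟨_, mk_mem_quotPiece I hu⟩
  have hperf : B.IsPerfPair := .of_injective hinj hinj'
  obtain ⟨c, hc⟩ := hperf.bijective_left.2 φ
  exact ⟨c, c.2, fun x => by rw [← hc, hB]⟩

theorem exists_add_eq_of_le_degree {σ : Type*} {k : ℕ} (s : σ →₀ ℕ) (hk : k ≤ s.degree) :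
    ∃ u v : σ →₀ ℕ, u + v = s ∧ v.degree = k := by
  obtain ⟨v, hle, hv⟩ := Finsupp.exists_le_degree_eq s k hk
  exact ⟨s - v, v, tsub_add_cancel_of_le hle, hv⟩

theorem eq_of_le_of_degree_eq {σ : Type*} {v w : σ →₀ ℕ} (hle : v ≤ w)
    (h : v.degree = w.degree) : v = w := by
  obtain ⟨u, rfl⟩ := exists_add_of_le hle
  rw [map_add, left_eq_add, Finsupp.degree_eq_zero_iff] at h
  rw [h, add_zero]

/-- If `η` satisfies the linear syzygies of the monomials of degree `k`, then
`p * η q` depends only on the product `p * q` for monomials `p` and `q` with `q` of degree `k`. -/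
theorem mk_monomial_mul_eq {I : Ideal (S n)} {k : ℕ} {η : S n →ₗ[ℂ] S n ⧸ I}
    (hη : ∀ i j, ∀ w : S n, (X j * w).IsHomogeneous k → (X i * w).IsHomogeneous k →
      Ideal.Quotient.mk I (X i) * η (X j * w) = Ideal.Quotient.mk I (X j) * η (X i * w))
    {u v u' v' : Fin (n + 1) →₀ ℕ} (huv : u + v = u' + v') (hv : v.degree = k)
    (hv' : v'.degree = k) :
    Ideal.Quotient.mk I (monomial u 1) * η (monomial v 1) =
      Ideal.Quotient.mk I (monomial u' 1) * η (monomial v' 1) := by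
  induction hm : (v - v').degree generalizing u v with
  | zero =>
    rw [Finsupp.degree_eq_zero_iff, tsub_eq_zero_iff_le] at hm
    obtain rfl := eq_of_le_of_degree_eq hm (hv.trans hv'.symm)
    rw [add_right_cancel huv]
  | succ m ih =>
    obtain ⟨i, hi⟩ : ∃ i, v' i < v i := by
      by_contra! h
      rw [tsub_eq_zero_iff_le.2 (Finsupp.le_def.2 h)] at hm
      simp at hm
    obtain ⟨j, hj⟩ : ∃ j, v j < v' j := by
      by_contra! h
      obtain rfl := eq_of_le_of_degree_eq (Finsupp.le_def.2 h) (hv'.trans hv.symm)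
      omega
    have hij : i ≠ j := by
      rintro rfl
      omega
    have huj : u j ≠ 0 := by
      have := DFunLike.congr_fun huv j
      simp only [Finsupp.add_apply] at this
      omega
    obtain ⟨w, rfl⟩ : ∃ w, v = Finsupp.single i 1 + w := by
      obtain ⟨w, hw⟩ := exists_add_of_le (a := Finsupp.single i 1) (b := v) (by
        rw [Finsupp.single_le_iff]
        omega)
      exact ⟨w, hw⟩
    obtain ⟨c, rfl⟩ : ∃ c, u = c + Finsupp.single j 1 := by
      obtain ⟨c, hc⟩ := exists_add_of_le (a := Finsupp.single j 1) (b := u) (by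
        rw [Finsupp.single_le_iff]
        omega)
      exact ⟨c, hc.trans (add_comm _ _)⟩
    have hdeg : (Finsupp.single j 1 + w).degree = k := by
      simpa using hv
    rw [← ih (u := c + Finsupp.single i 1) (v := Finsupp.single j 1 + w) _ hdeg]
    · have hX : ∀ (l : Fin (n + 1)) (t : Fin (n + 1) →₀ ℕ),
          (monomial (Finsupp.single l 1 + t) 1 : S n) = X l * monomial t 1 := by
        intro l t
        rw [X, monomial_mul, mul_one]
      have hXi : (X i * monomial w 1 : S n).IsHomogeneous k := by
        rw [← hX]
        exact isHomogeneous_monomial _ hv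
      have hXj : (X j * monomial w 1 : S n).IsHomogeneous k := by
        rw [← hX]
        exact isHomogeneous_monomial _ hdeg
      rw [hX, hX, add_comm c, add_comm c, hX, hX, map_mul (Ideal.Quotient.mk I) (X j),
        map_mul (Ideal.Quotient.mk I) (X i), mul_right_comm, hη j i _ hXi hXj]
      ring
    · have hsub : Finsupp.single i 1 + w - v' = (Finsupp.single j 1 + w - v') +
          Finsupp.single i 1 := by
        ext l
        simp only [Finsupp.add_apply, Finsupp.tsub_apply, Finsupp.single_apply] at hi hj ⊢
        by_cases hli : i = l
        · subst hli
          simp only [if_true, hij.symm, if_false] at hi ⊢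
          omega
        · by_cases hlj : j = l
          · subst hlj
            simp only [if_true, hij, if_false] at hj ⊢
            omega
          · simp [hli, hlj]
      rw [hsub, map_add, Finsupp.degree_single] at hm
      omega
    · rw [← huv]
      abel

theorem exists_extension_of_syzygies {I : Ideal (S n)} {k : ℕ} {η : S n →ₗ[ℂ] S n ⧸ I}
    (hη : ∀ i j, ∀ w : S n, (X j * w).IsHomogeneous k → (X i * w).IsHomogeneous k →
      Ideal.Quotient.mk I (X i) * η (X j * w) = Ideal.Quotient.mk I (X j) * η (X i * w)) :
    ∃ H : S n →ₗ[ℂ] S n ⧸ I, ∀ p q : S n, q.IsHomogeneous k →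
      H (p * q) = Ideal.Quotient.mk I p * η q := by
  have hval : ∀ s : Fin (n + 1) →₀ ℕ, ∃ y : S n ⧸ I, ∀ u v, u + v = s → v.degree = k →
      y = Ideal.Quotient.mk I (monomial u 1) * η (monomial v 1) := by
    intro s
    by_cases hs : k ≤ s.degree
    · obtain ⟨u', v', huv', hv'⟩ := exists_add_eq_of_le_degree s hs
      exact ⟨_, fun u v huv hv => mk_monomial_mul_eq hη (huv'.trans huv.symm) hv' hv⟩
    · refine ⟨0, fun u v huv hv => absurd ?_ hs⟩
      rw [← huv, map_add, hv]
      exact Nat.le_add_left _ _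
  choose y hy using hval
  let H : S n →ₗ[ℂ] S n ⧸ I := (basisMonomials (Fin (n + 1)) ℂ).constr ℂ y
  have hH : ∀ s, H (monomial s 1) = y s := by
    intro s
    simpa using (basisMonomials (Fin (n + 1)) ℂ).constr_basis ℂ y s
  refine ⟨H, fun p q hq => ?_⟩
  have hmon : ∀ s, H (monomial s 1 * q) = Ideal.Quotient.mk I (monomial s 1) * η q := by
    intro s
    refine mem_of_forall_monomial_mem (M := LinearMap.eqLocus
      (H ∘ₗ LinearMap.mulLeft ℂ (monomial s 1))
      (LinearMap.mulLeft ℂ (Ideal.Quotient.mk I (monomial s 1)) ∘ₗ η)) (fun m hm => ?_) hq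
    simp only [LinearMap.mem_eqLocus, LinearMap.comp_apply, LinearMap.mulLeft_apply]
    rw [monomial_mul, mul_one, hH]
    exact hy _ _ _ rfl hm
  have hlin : H ∘ₗ LinearMap.mulRight ℂ q =
      LinearMap.mulRight ℂ (η q) ∘ₗ (Ideal.Quotient.mkₐ ℂ I).toLinearMap :=
    (basisMonomials (Fin (n + 1)) ℂ).ext fun s => by simpa using hmon s
  exact LinearMap.congr_fun hlin p

theorem extension_eq_zero_of_mem {ι : Type*} [Fintype ι] {f : ι → S n} {D : ℕ}
    (hf : ∀ i, (f i).IsHomogeneous D) {I : Ideal (S n)} (hI : I = Ideal.span (Set.range f))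
    {k : ℕ} {η H : S n →ₗ[ℂ] S n ⧸ I}
    (hH : ∀ p q : S n, q.IsHomogeneous k → H (p * q) = Ideal.Quotient.mk I p * η q)
    {t : ℕ} (hkt : k ≤ t) {q : S n} (hq : q.IsHomogeneous (D + t)) (hqI : q ∈ I) : H q = 0 := by
  have hfI : ∀ i, f i ∈ I := fun i => hI ▸ Ideal.subset_span ⟨i, rfl⟩
  have hzero : ∀ i, ∀ g : S n, g.IsHomogeneous t → H (f i * g) = 0 := by
    intro i g hg
    refine mem_of_forall_monomial_mem (M := LinearMap.ker (H ∘ₗ LinearMap.mulLeft ℂ (f i)))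
      (fun m hm => ?_) hg
    obtain ⟨u, v, rfl, hv⟩ := exists_add_eq_of_le_degree m (hkt.trans hm.ge)
    have hmul : (monomial (u + v) 1 : S n) = monomial u 1 * monomial v 1 := by
      rw [monomial_mul, mul_one]
    rw [LinearMap.mem_ker, LinearMap.comp_apply, LinearMap.mulLeft_apply, hmul, ← mul_assoc,
      hH _ _ (isHomogeneous_monomial _ hv), map_mul, Ideal.Quotient.eq_zero_iff_mem.2 (hfI i),
      zero_mul, zero_mul]
  rw [hI, Ideal.mem_span_range_iff_exists_fun] at hqI
  obtain ⟨g, rfl⟩ := hqI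
  rw [← homogeneousComponent_eq_self hq, map_sum, map_sum]
  refine Finset.sum_eq_zero fun i _ => ?_
  rw [mul_comm, homogeneousComponent_mul_of_isHomogeneous (hf i)]
  exact hzero i _ (homogeneousComponent_isHomogeneous t _)

theorem exists_functional_quotPiece {I : Ideal (S n)} {e : ℕ} (Λ : S n →ₗ[ℂ] ℂ)
    (hΛ : ∀ q : S n, q.IsHomogeneous e → q ∈ I → Λ q = 0) :
    ∃ φ : quotPiece I e →ₗ[ℂ] ℂ, ∀ (q : S n) (hq : q.IsHomogeneous e),
      φ ⟨_, mk_mem_quotPiece I hq⟩ = Λ q := by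
  let V := homogeneousSubmodule (Fin (n + 1)) ℂ e
  let π : V →ₗ[ℂ] quotPiece I e := (Ideal.Quotient.mkₐ ℂ I).toLinearMap.submoduleMap V
  have hπ : Function.Surjective π := LinearMap.submoduleMap_surjective _ _
  obtain ⟨s, hs⟩ := π.exists_rightInverse_of_surjective (LinearMap.range_eq_top.2 hπ)
  refine ⟨Λ ∘ₗ V.subtype ∘ₗ s, fun q hq => ?_⟩
  let x : quotPiece I e := ⟨_, mk_mem_quotPiece I hq⟩
  have hx : π (s x) = x := LinearMap.congr_fun hs x
  have hmem : (s x : S n) - q ∈ I := Ideal.Quotient.eq.1 (congrArg Subtype.val hx)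
  have := hΛ _ ((s x).2.sub hq) hmem
  rw [map_sub, sub_eq_zero] at this
  exact this

theorem SocleDegree.exists_mul_eq {I : Ideal (S n)} {N k k' : ℕ} (hI : SocleDegree I N)
    (hkk' : k ≤ k') (hsum : k + k' < N) {D : ℕ} (hD : D + k' ≤ N) {ι : Type*} [Fintype ι]
    {f : ι → S n} (hf : ∀ i, (f i).IsHomogeneous D) (hIf : I = Ideal.span (Set.range f))
    (h : quotPiece I k →ₗ[ℂ] (S n ⧸ I)) (hmem : ∀ a : quotPiece I k, h a ∈ quotPiece I k')
    (hsymm : ∀ a b : quotPiece I k, (a : S n ⧸ I) * h b = (b : S n ⧸ I) * h a) :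
    ∃ c ∈ quotPiece I (k' - k), ∀ a : quotPiece I k, h a = c * (a : S n ⧸ I) := by
  obtain ⟨g, hg⟩ := LinearMap.exists_extend h
  let η : S n →ₗ[ℂ] S n ⧸ I := g ∘ₗ (Ideal.Quotient.mkₐ ℂ I).toLinearMap
  have hη : ∀ (q : S n) (hq : q.IsHomogeneous k), η q = h ⟨_, mk_mem_quotPiece I hq⟩ :=
    fun q hq => LinearMap.congr_fun hg ⟨_, mk_mem_quotPiece I hq⟩
  have hη_mem : ∀ q : S n, q.IsHomogeneous k → η q ∈ quotPiece I k' := fun q hq =>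
    hη q hq ▸ hmem _
  have hη_symm : ∀ p q : S n, p.IsHomogeneous k → q.IsHomogeneous k →
      Ideal.Quotient.mk I p * η q = Ideal.Quotient.mk I q * η p := fun p q hp hq => by
    rw [hη p hp, hη q hq]
    exact hsymm ⟨_, mk_mem_quotPiece I hp⟩ ⟨_, mk_mem_quotPiece I hq⟩
  obtain ⟨H, hH⟩ := exists_extension_of_syzygies (I := I) (k := k) (η := η) (by
    intro i j w hj hi
    rw [← sub_eq_zero]
    refine hI.eq_zero_of_forall_mul (j := 1 + k') (t := k) (by omega)
      (Submodule.sub_mem _ (mul_mem_quotPiece (mk_mem_quotPiece I (isHomogeneous_X ℂ i))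
        (hη_mem _ hj)) (mul_mem_quotPiece (mk_mem_quotPiece I (isHomogeneous_X ℂ j))
        (hη_mem _ hi))) fun u hu => ?_
    rw [mul_sub, mul_left_comm, hη_symm u _ hu hj, mul_left_comm (Ideal.Quotient.mk I u),
      hη_symm u _ hu hi, map_mul (Ideal.Quotient.mk I), map_mul (Ideal.Quotient.mk I)]
    ring)
  obtain ⟨ε, hε⟩ := hI.exists_functional
  obtain ⟨φ, hφ⟩ := exists_functional_quotPiece (I := I) (e := N - k' + k) (ε ∘ₗ H) (by
    intro q hq hqI
    have : N - k' + k = D + (N - k' + k - D) := by omega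
    rw [LinearMap.comp_apply, extension_eq_zero_of_mem hf hIf hH (by omega) (this ▸ hq) hqI,
      map_zero])
  obtain ⟨c, hc, hcφ⟩ := hI.exists_eq_functional_mul hε (i := k' - k) (by omega) φ
  refine ⟨c, hc, fun ⟨a, ha⟩ => ?_⟩
  obtain ⟨q, hq, rfl⟩ := mem_quotPiece.1 ha
  rw [← hη q hq, ← sub_eq_zero]
  have hck : c * Ideal.Quotient.mk I q ∈ quotPiece I k' := by
    have := mul_mem_quotPiece hc (mk_mem_quotPiece I hq)
    rwa [Nat.sub_add_cancel hkk'] at this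
  have hdiff := Submodule.sub_mem _ (hη_mem q hq) hck
  refine hI.eq_zero_of_forall_mul (t := N - k') (by omega) hdiff fun u hu => hε _ ?_ ?_
  · have := mul_mem_quotPiece (mk_mem_quotPiece I hu) hdiff
    rwa [Nat.sub_add_cancel (by omega)] at this
  · have h₁ := hφ (u * q) (hu.mul hq)
    simp only [hcφ, LinearMap.comp_apply, hH u q hq, map_mul (Ideal.Quotient.mk I)] at h₁
    rw [mul_sub, map_sub, ← h₁, mul_left_comm, sub_self]

end Symmetrizers

/-- Symmetrizer lemma, Donagi / Donagi–Green.
For a regular sequence `f₀,…,fₙ` of degree `d-1` forms, with `R = S/(f₀,…,fₙ)`,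
`N = (n+1)(d-2)`, `k ≤ k'`, `max(k, N-k') ≥ d-1` and `N-k-k' > 0`, the multiplication map
`R^{k'-k} → Hom(R^k, R^{k'})` is an isomorphism onto the space of symmetrizers. -/
theorem symmetrizer_lemma (n d : ℕ) (hn : 1 ≤ n) (hd : 3 ≤ d)
    (f : Fin (n + 1) → S n) (hf : ∀ i, (f i).IsHomogeneous (d - 1))
    (hreg : IsRegularSeq f)
    (I : Ideal (S n)) (hI : I = Ideal.span (Set.range f))
    (k k' : ℕ) (hkk' : k ≤ k')
    (hmax : (d : ℤ) - 1 ≤ max (k : ℤ) ((((n + 1) * (d - 2) : ℕ) : ℤ) - k'))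
    (hsum : 0 < (((n + 1) * (d - 2) : ℕ) : ℤ) - k - k') :
    -- multiplication maps `R^{k'-k} ⊗ R^k` into `R^{k'}`, each product map is a symmetrizer,
    (∀ c ∈ quotPiece I (k' - k), ∀ a ∈ quotPiece I k, c * a ∈ quotPiece I k') ∧
    -- the map `R^{k'-k} → Hom(R^k, R^{k'})` is injective,
    (∀ c ∈ quotPiece I (k' - k), (∀ a ∈ quotPiece I k, c * a = 0) → c = 0) ∧
    -- and every symmetrizer `h : R^k → R^{k'}` is given by multiplication by some
    -- `c ∈ R^{k'-k}` (surjectivity onto the symmetrizer subspace).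
    (∀ h : quotPiece I k →ₗ[ℂ] (S n ⧸ I),
      (∀ a : quotPiece I k, h a ∈ quotPiece I k') →
      (∀ a b : quotPiece I k, (a : S n ⧸ I) * h b = (b : S n ⧸ I) * h a) →
      ∃ c ∈ quotPiece I (k' - k), ∀ a : quotPiece I k, h a = c * (a : S n ⧸ I)) := by
  have hsocle : SocleDegree I ((n + 1) * (d - 2)) :=
    hI ▸ socleDegree_of_isRegularSeq (fun i => by convert hf i using 1; omega) hreg
  generalize (n + 1) * (d - 2) = N at hmax hsum hsocle
  have hmul : ∀ c ∈ quotPiece I (k' - k), ∀ a ∈ quotPiece I k, c * a ∈ quotPiece I k' := by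
    intro c hc a ha
    have := mul_mem_quotPiece hc ha
    rwa [Nat.sub_add_cancel hkk'] at this
  refine ⟨hmul, fun c hc h => ?_, fun h hmem hsymm => ?_⟩
  · refine hsocle.eq_zero_of_forall_mul (t := k) (by omega) hc fun u hu => ?_
    rw [mul_comm]
    exact h _ (mk_mem_quotPiece I hu)
  · exact hsocle.exists_mul_eq hkk' (by omega) (by omega) hf hI h hmem hsymm

end
end

section
/- Let f, g ∈ S^d be homogeneous polynomials of degree d in n+1 variables, each defining a smooth hypersurface in P^n (i.e., the partial derivatives have no common zero in ℂ^{n+1} \ {0}). If the degree-(d−1) pieces of the Jacobian ideals coincide, i.e., the linear span of ∂f/∂X_0,…,∂f/∂X_n in S^{d-1} equals the linear span of ∂g/∂X_0,…,∂g/∂X_n, then f and g are in the same orbit under PGL(n+1): there exist an invertible linear change of coordinates A ∈ GL(n+1, ℂ) and a nonzero scalar λ ∈ ℂ such that g(X) = λ·f(A·X). -/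
open MvPolynomial

noncomputable section

section

open scoped Polynomial

theorem IsUnit.exists_pow_eq_of_finiteDimensional {K A : Type*} [Field K] [IsAlgClosed K]
    [CharZero K] [CommRing A] [Algebra K A] [FiniteDimensional K A] {x : A} (hx : IsUnit x)
    {d : ℕ} (hd : d ≠ 0) : ∃ z : A, z ^ d = x := by
  classical
  set m := minpoly K x with hm
  choose r hr using fun μ : K => IsAlgClosed.exists_pow_nat_eq μ (Nat.pos_of_ne_zero hd)
  let q : K[X] := Lagrange.interpolate m.roots.toFinset id r
  have hdvd : m ∣ (q ^ d - Polynomial.X) ^ m.roots.card := by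
    have hprod : m = (m.roots.map fun a => Polynomial.X - Polynomial.C a).prod :=
      (IsAlgClosed.splits m).eq_prod_roots_of_monic
        (minpoly.monic (Algebra.IsIntegral.isIntegral x))
    conv_lhs => rw [hprod]
    rw [← Multiset.prod_replicate, ← Multiset.map_const']
    refine Multiset.prod_dvd_prod_of_dvd _ _ fun a ha => ?_
    rw [Polynomial.dvd_iff_isRoot, Polynomial.IsRoot.def, Polynomial.eval_sub,
      Polynomial.eval_pow, Polynomial.eval_X, sub_eq_zero]
    have hqa : Polynomial.eval a q = r a :=
      Lagrange.eval_interpolate_at_node r (Set.injOn_id _) (Multiset.mem_toFinset.2 ha)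
    rw [hqa, hr]
  let y := Polynomial.aeval x q
  have hy : IsNilpotent (y ^ d - x) := by
    obtain ⟨c, hc⟩ := hdvd
    exact ⟨m.roots.card, by simpa [hm] using congrArg (Polynomial.aeval x) hc⟩
  have hyu : IsUnit y := by
    rw [← isUnit_pow_iff hd, ← sub_add_cancel (y ^ d) x]
    exact hy.isUnit_add_right_of_commute hx (Commute.all _ _)
  have hdu : IsUnit (d : A) := by
    simpa using (IsUnit.mk0 (d : K) (by exact_mod_cast hd)).map (algebraMap K A)
  obtain ⟨z, ⟨-, hz⟩, -⟩ :=
    Polynomial.existsUnique_nilpotent_sub_and_aeval_eq_zero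
    (P := Polynomial.X ^ d - Polynomial.C x) (x := y) (by simpa using hy)
    (by simpa [Polynomial.derivative_X_pow] using hdu.mul (hyu.pow (d - 1)))
  exact ⟨z, by simpa [sub_eq_zero] using hz⟩

theorem IsUnit.exists_aeval_pow_eq_of_finiteDimensional {K A : Type*} [Field K] [IsAlgClosed K]
    [CharZero K] [Ring A] [Algebra K A] [FiniteDimensional K A] {b : A} (hb : IsUnit b)
    {d : ℕ} (hd : d ≠ 0) : ∃ p : K[X], Polynomial.aeval b p ^ d = b := by
  let R := Algebra.adjoin K {b}
  let x : R := ⟨b, Algebra.self_mem_adjoin_singleton K b⟩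
  have hx : IsUnit x := by
    have : IsArtinianRing R := IsArtinianRing.of_finite K R
    refine IsArtinianRing.isUnit_of_mem_nonZeroDivisors
      (mem_nonZeroDivisors_iff_right.2 fun z hz => Subtype.ext ?_)
    exact hb.mul_left_eq_zero.1 (congrArg Subtype.val hz)
  obtain ⟨z, hz⟩ := hx.exists_pow_eq_of_finiteDimensional (K := K) hd
  obtain ⟨p, hp⟩ : (z : A) ∈ (Polynomial.aeval b : K[X] →ₐ[K] A).range :=
    Algebra.adjoin_singleton_eq_range_aeval K b ▸ z.2
  refine ⟨p, ?_⟩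
  rw [show Polynomial.aeval b p = z from hp]
  exact congrArg Subtype.val hz

end

namespace MvPolynomial

theorem IsHomogeneous.eval_eq_eval {σ R : Type*} [CommSemiring R] {f : MvPolynomial σ R}
    (hf : f.IsHomogeneous 0) (x y : σ → R) : eval x f = eval y f := by
  rw [totalDegree_eq_zero_iff_eq_C.1 (Nat.le_zero.1 hf.totalDegree_le), eval_C, eval_C]

variable {σ K : Type*} [Field K]

theorem pderiv_comm (i j : σ) (f : MvPolynomial σ K) :
    pderiv i (pderiv j f) = pderiv j (pderiv i f) := by
  classical
  have h : ⁅pderiv (R := K) i, pderiv j⁆ = 0 :=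
    derivation_ext fun k => by
      rw [Derivation.commutator_apply]
      simp [pderiv_X, Pi.single_apply, apply_ite]
  rw [← sub_eq_zero, ← Derivation.commutator_apply, h, Derivation.zero_apply]

variable [Fintype σ]

/-- The directional derivative along a constant vector field, linear in the direction. -/
noncomputable def dirDeriv : (σ → K) →ₗ[K] Module.End K (MvPolynomial σ K) :=
  Fintype.linearCombination K fun i => (pderiv i).toLinearMap

theorem dirDeriv_apply (v : σ → K) (f : MvPolynomial σ K) :
    dirDeriv v f = ∑ i, v i • pderiv i f := by
  simp [dirDeriv, Fintype.linearCombination_apply]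

theorem dirDeriv_comm (u v : σ → K) (f : MvPolynomial σ K) :
    dirDeriv u (dirDeriv v f) = dirDeriv v (dirDeriv u f) := by
  simp only [dirDeriv_apply, map_sum, map_smul, Finset.smul_sum]
  rw [Finset.sum_comm]
  refine Finset.sum_congr rfl fun i _ => Finset.sum_congr rfl fun j _ => ?_
  rw [pderiv_comm, smul_comm]

theorem IsHomogeneous.dirDeriv {f : MvPolynomial σ K} {d : ℕ} (hf : f.IsHomogeneous d)
    (v : σ → K) : (dirDeriv v f).IsHomogeneous (d - 1) := by
  rw [dirDeriv_apply]
  refine IsHomogeneous.sum _ _ _ fun i _ => ?_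
  rw [smul_eq_C_mul]
  exact hf.pderiv.C_mul _

theorem IsHomogeneous.eval_dirDeriv_self {f : MvPolynomial σ K} {d : ℕ} (hf : f.IsHomogeneous d)
    (x : σ → K) : eval x (MvPolynomial.dirDeriv x f) = d * eval x f := by
  simpa [dirDeriv_apply] using congrArg (eval x) hf.sum_X_mul_pderiv

/-- An endomorphism is self-adjoint for `f` if it is self-adjoint for every Hessian of `f`. -/
def HessianSelfAdjoint (f : MvPolynomial σ K) (T : Module.End K (σ → K)) : Prop :=
  ∀ u v, dirDeriv (T u) (dirDeriv v f) = dirDeriv u (dirDeriv (T v) f)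

namespace HessianSelfAdjoint
variable {f : MvPolynomial σ K} {T : Module.End K (σ → K)}

theorem of_dirDeriv_eq {g : MvPolynomial σ K} (h : ∀ v, dirDeriv v g = dirDeriv (T v) f) :
    HessianSelfAdjoint f T := fun u v => by
  rw [dirDeriv_comm, ← h, ← h, dirDeriv_comm]

theorem dirDeriv (h : HessianSelfAdjoint f T) (w : σ → K) :
    HessianSelfAdjoint (MvPolynomial.dirDeriv w f) T := fun u v => by
  rw [dirDeriv_comm v, dirDeriv_comm (T u), h, dirDeriv_comm w u, dirDeriv_comm w (T v)]

theorem pow (h : HessianSelfAdjoint f T) (k : ℕ) : HessianSelfAdjoint f (T ^ k) := by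
  induction k with
  | zero => exact fun u v => rfl
  | succ k ih =>
    intro u v
    rw [pow_succ, Module.End.mul_apply, ih, h, ← Module.End.mul_apply T, ← pow_succ', ← pow_succ]

theorem aeval (h : HessianSelfAdjoint f T) (p : Polynomial K) :
    HessianSelfAdjoint f (Polynomial.aeval T p) := by
  induction p using Polynomial.induction_on' with
  | add p q hp hq =>
    intro u v
    simp only [map_add, LinearMap.add_apply, hp u v, hq u v]
  | monomial k a =>
    intro u v
    simp [Polynomial.aeval_monomial, ← Algebra.smul_def, h.pow k u v]

variable [CharZero K]

theorem eval_dirDeriv_apply (h : HessianSelfAdjoint f T) {d : ℕ} (hf : f.IsHomogeneous (d + 1))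
    (v x : σ → K) :
    eval (T x) (MvPolynomial.dirDeriv v f) = eval x (MvPolynomial.dirDeriv ((T ^ d) v) f) := by
  induction d generalizing f v with
  | zero => exact (hf.dirDeriv v).eval_eq_eval (T x) x
  | succ d ih =>
    have h1 (w : σ → K) : (MvPolynomial.dirDeriv w f).IsHomogeneous (d + 1) := hf.dirDeriv w
    apply mul_left_cancel₀ (Nat.cast_ne_zero.2 d.succ_ne_zero : ((d + 1 : ℕ) : K) ≠ 0)
    rw [← (h1 _).eval_dirDeriv_self, ih (h.dirDeriv v) (h1 v), ← (h1 _).eval_dirDeriv_self,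
      ← Module.End.mul_apply (T ^ d), ← pow_succ, h.pow]

theorem eval_apply (h : HessianSelfAdjoint f T) {d : ℕ} (hf : f.IsHomogeneous d) (hd : d ≠ 0)
    (x : σ → K) :
    d * eval (T x) f = eval x (MvPolynomial.dirDeriv ((T ^ d) x) f) := by
  obtain ⟨d, rfl⟩ := Nat.exists_eq_succ_of_ne_zero hd
  rw [← hf.eval_dirDeriv_self, h.eval_dirDeriv_apply hf, ← Module.End.mul_apply (T ^ d), ← pow_succ]

end HessianSelfAdjoint

/-- If the derivatives satisfy `∇g = Tᵀ ∇f`, then `g = f ∘ A` with `A ^ d = T`. -/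
theorem exists_isUnit_eval_eq_of_dirDeriv_eq [IsAlgClosed K] [CharZero K]
    {f g : MvPolynomial σ K} {d : ℕ} (hd : d ≠ 0)
    (hf : f.IsHomogeneous d) (hg : g.IsHomogeneous d) {T : Module.End K (σ → K)} (hT : IsUnit T)
    (h : ∀ v, dirDeriv v g = dirDeriv (T v) f) :
    ∃ A : Module.End K (σ → K), IsUnit A ∧ ∀ x, eval x g = eval (A x) f := by
  obtain ⟨p, hp⟩ := hT.exists_aeval_pow_eq_of_finiteDimensional (K := K) hd
  refine ⟨Polynomial.aeval T p, (isUnit_pow_iff hd).1 (hp.symm ▸ hT), fun x => ?_⟩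
  apply mul_left_cancel₀ (Nat.cast_ne_zero.2 hd : (d : K) ≠ 0)
  rw [((HessianSelfAdjoint.of_dirDeriv_eq h).aeval p).eval_apply hf hd, hp, ← h,
    hg.eval_dirDeriv_self]

theorem eval_dirDeriv_eq_zero_of_dirDeriv_eq_zero [CharZero K] {f : MvPolynomial σ K} {d : ℕ}
    (hd : 2 ≤ d) (hf : f.IsHomogeneous d) {v : σ → K} (hv : dirDeriv v f = 0) (w : σ → K) :
    eval v (dirDeriv w f) = 0 := by
  have := (hf.dirDeriv w).eval_dirDeriv_self v
  rw [dirDeriv_comm, hv, map_zero, map_zero, eq_comm, mul_eq_zero] at this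
  exact this.resolve_left (Nat.cast_ne_zero.2 (by omega))

theorem exists_dirDeriv_eq_of_span_le {f g : MvPolynomial σ K}
    (h : Submodule.span K (Set.range fun i => pderiv i g) ≤
      Submodule.span K (Set.range fun i => pderiv i f)) :
    ∃ T : Module.End K (σ → K), ∀ v, dirDeriv v g = dirDeriv (T v) f := by
  classical
  have h' (i : σ) : ∃ w : σ → K, dirDeriv w f = pderiv i g := by
    rw [← Fintype.range_linearCombination, ← Fintype.range_linearCombination] at h
    obtain ⟨w, hw⟩ := h ⟨Pi.single i 1, rfl⟩
    exact ⟨w, by simpa [dirDeriv_apply, Fintype.linearCombination_apply] using hw⟩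
  choose w hw using h'
  refine ⟨Fintype.linearCombination K w, fun v => ?_⟩
  simp [Fintype.linearCombination_apply, dirDeriv_apply v, hw]

theorem exists_isUnit_eval_eq_of_isHomogeneous_one {f g : MvPolynomial σ ℂ}
    (hf : f.IsHomogeneous 1) (hg : g.IsHomogeneous 1) (hf0 : f ≠ 0) (hg0 : g ≠ 0) :
    ∃ A : Module.End ℂ (σ → ℂ), IsUnit A ∧ ∀ x, eval x g = eval (A x) f := by
  classical
  have key {p : MvPolynomial σ ℂ} (hp : p.IsHomogeneous 1) (x : σ → ℂ) :
      eval x p = x ⬝ᵥ fun i => eval 0 (pderiv i p) := by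
    have := hp.eval_dirDeriv_self x
    rw [Nat.cast_one, one_mul] at this
    rw [← this, dirDeriv_apply, map_sum]
    refine Finset.sum_congr rfl fun i _ => ?_
    rw [smul_eval, (hp.pderiv (i := i)).eval_eq_eval x 0]
  have key0 {p : MvPolynomial σ ℂ} (hp : p.IsHomogeneous 1) (hp0 : p ≠ 0) :
      (fun i => eval 0 (pderiv i p)) ≠ (0 : σ → ℂ) := fun h =>
    hp0 (funext fun x => by rw [key hp, h, dotProduct_zero, map_zero])
  obtain ⟨B, hB⟩ := SeparatingDual.exists_continuousLinearEquiv_apply_eq (R := ℂ)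
    (key0 hf hf0) (key0 hg hg0)
  let M := LinearMap.toMatrix' (B : (σ → ℂ) →ₗ[ℂ] σ → ℂ)
  have hM : IsUnit M :=
    ((Module.End.isUnit_iff _).2 B.bijective).map LinearMap.toMatrixAlgEquiv'
  refine ⟨Matrix.toLinAlgEquiv' M.transpose, ((Matrix.isUnit_transpose M).2 hM).map _, fun x => ?_⟩
  rw [key hf, key hg, ← hB, Matrix.toLinAlgEquiv'_apply, Matrix.mulVec_transpose,
    ← Matrix.dotProduct_mulVec, LinearMap.toMatrix'_mulVec]
  rfl

end MvPolynomial

theorem SmoothHyp.ne_zero {n : ℕ} {f : S n} (hf : SmoothHyp f) : f ≠ 0 := by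
  rintro rfl
  exact one_ne_zero (hf 1 fun i => by simp)

theorem SmoothHyp.degree_ne_zero {n d : ℕ} {f : S n} (hf : SmoothHyp f) (hd : f.IsHomogeneous d) :
    d ≠ 0 := by
  rintro rfl
  refine one_ne_zero (hf 1 fun i => ?_)
  rw [totalDegree_eq_zero_iff_eq_C.1 (Nat.le_zero.1 hd.totalDegree_le), pderiv_C, map_zero]

theorem SmoothHyp.eq_zero_of_dirDeriv_eq_zero {n d : ℕ} {f : S n} (hf : SmoothHyp f)
    (hd : f.IsHomogeneous d) (hd2 : 2 ≤ d) {v : Fin (n + 1) → ℂ} (hv : dirDeriv v f = 0) :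
    v = 0 :=
  hf v fun i => by
    simpa [dirDeriv_apply, Pi.single_apply] using
      eval_dirDeriv_eq_zero_of_dirDeriv_eq_zero hd2 hd hv (Pi.single i 1)

theorem eval_substLin {n : ℕ} (A : Matrix (Fin (n + 1)) (Fin (n + 1)) ℂ) (f : S n)
    (x : Fin (n + 1) → ℂ) : eval x (substLin A f) = eval (A.mulVec x) f := by
  rw [substLin, aeval_def, ← coe_eval₂Hom, ← RingHom.comp_apply]
  congr 1
  ext i <;> simp [Matrix.mulVec, dotProduct]

/-- Carlson–Griffiths / Donagi / Mather–Yau.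
If `f, g` are degree-`d` forms defining smooth hypersurfaces in `ℙⁿ` and the spans of their
partial derivatives in `S^{d-1}` coincide, then `f` and `g` are in the same orbit under
`PGL(n+1)`: `g(X) = λ · f(A·X)` for some `A ∈ GL(n+1, ℂ)` and `λ ≠ 0`. -/
theorem jacobian_determines_hypersurface (n d : ℕ) (f g : S n)
    (hf : f.IsHomogeneous d) (hg : g.IsHomogeneous d)
    (hfs : SmoothHyp f) (hgs : SmoothHyp g)
    (hJ : Submodule.span ℂ (Set.range fun i => (MvPolynomial.pderiv i f : S n)) =
          Submodule.span ℂ (Set.range fun i => (MvPolynomial.pderiv i g : S n))) :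
    ∃ (A : Matrix.GeneralLinearGroup (Fin (n + 1)) ℂ) (lam : ℂ), lam ≠ 0 ∧
      g = lam • substLin (A : Matrix (Fin (n + 1)) (Fin (n + 1)) ℂ) f := by
  obtain ⟨A, hA, hAfg⟩ : ∃ A : Module.End ℂ (Fin (n + 1) → ℂ), IsUnit A ∧
      ∀ x, eval x g = eval (A x) f := by
    have hd := hfs.degree_ne_zero hf
    obtain rfl | hd2 : d = 1 ∨ 2 ≤ d := by omega
    · exact exists_isUnit_eval_eq_of_isHomogeneous_one hf hg hfs.ne_zero hgs.ne_zero
    · obtain ⟨T, hT⟩ := exists_dirDeriv_eq_of_span_le hJ.ge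
      have hker : LinearMap.ker T = ⊥ := LinearMap.ker_eq_bot'.2 fun v hv =>
        hgs.eq_zero_of_dirDeriv_eq_zero hg hd2 (by rw [hT, hv, map_zero, LinearMap.zero_apply])
      exact exists_isUnit_eval_eq_of_dirDeriv_eq hd hf hg
        ((LinearMap.isUnit_iff_ker_eq_bot T).2 hker) hT
  refine ⟨(hA.map LinearMap.toMatrixAlgEquiv').unit, 1, one_ne_zero, funext fun x => ?_⟩
  rw [one_smul, eval_substLin, hAfg, IsUnit.unit_spec, ← Matrix.toLinAlgEquiv'_apply,
    Matrix.toLinAlgEquiv'_toMatrixAlgEquiv']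

end
end

section
/- Let d ≥ 4 and n ≥ 4. For generic f ∈ S^d (i.e., for all f in some nonempty Zariski-open subset of S^d), the following holds: if g ∈ S^d defines a smooth hypersurface in P^n and the Jacobian ideals J_f and J_g coincide as ideals of S = ℂ[X_0,…,X_n], then f = μ·g for some scalar μ ∈ ℂ. -/
open MvPolynomial

noncomputable section

/-- Partial derivatives of polynomials commute. -/
theorem pderiv_comm_apply {σ R : Type*} [CommRing R] (i j : σ) (p : MvPolynomial σ R) :
    pderiv i (pderiv j p) = pderiv j (pderiv i p) := by
  classical
  have h : ⁅pderiv (R := R) i, pderiv (R := R) j⁆ = 0 := by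
    refine MvPolynomial.derivation_ext fun k => ?_
    rw [Derivation.commutator_apply]
    simp only [pderiv_X, Pi.single_apply]
    split_ifs <;> simp
  have := congrArg
    (fun D : Derivation R (MvPolynomial σ R) (MvPolynomial σ R) => D p) h
  simpa [Derivation.commutator_apply, sub_eq_zero] using this

/-- A homogeneous element of an ideal generated by finitely many forms of the same degree is a
linear combination of these forms with constant coefficients. -/
theorem exists_sum_smul_of_mem_span_homogeneous {σ ι R : Type*} [CommRing R] [Fintype ι] {m : ℕ}
    {q : ι → MvPolynomial σ R} (hq : ∀ j, (q j).IsHomogeneous m) {p : MvPolynomial σ R}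
    (hp : p.IsHomogeneous m) (h : p ∈ Ideal.span (Set.range q)) :
    ∃ a : ι → R, p = ∑ j, a j • q j := by
  let _ : GradedAlgebra (homogeneousSubmodule σ R) := MvPolynomial.gradedAlgebra
  obtain ⟨c, hc⟩ := (Submodule.mem_span_range_iff_exists_fun _).1 h
  have key (c : MvPolynomial σ R) (j : ι) :
      homogeneousComponent m (c * q j) = coeff 0 c • q j := by
    have h1 := DirectSum.coe_decompose_mul_add_of_right_mem (homogeneousSubmodule σ R)
      (a := c) (b := q j) (i := 0) (j := m) (hq j)
    have h2 (r : MvPolynomial σ R) (k : ℕ) :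
        (DirectSum.decompose (homogeneousSubmodule σ R) r k : MvPolynomial σ R) =
          homogeneousComponent k r := decomposition.decompose'_apply r k
    rw [h2, h2, zero_add, homogeneousComponent_zero, ← smul_eq_C_mul] at h1
    exact h1
  refine ⟨fun j => coeff 0 (c j), ?_⟩
  have h3 : homogeneousComponent m p = p := by
    rw [homogeneousComponent_of_mem hp, if_pos rfl]
  rw [← h3, ← hc, map_sum]
  exact Finset.sum_congr rfl fun j _ => key (c j) j

/-- The determinant of a matrix of polynomial functions is a polynomial function. -/
theorem IsPolyFun.det {M : Type} [AddCommGroup M] [Module ℂ M] {ι : Type*} [Fintype ι]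
    [DecidableEq ι] {N : M → Matrix ι ι ℂ} (hN : ∀ i j, IsPolyFun fun x => N x i j) :
    IsPolyFun fun x => (N x).det := by
  have h : (fun x => (N x).det) =
      ∑ τ : Equiv.Perm ι, ((Equiv.Perm.sign τ : ℤ) : M → ℂ) * ∏ i, (fun x => N x (τ i) i) := by
    funext x
    simp [Matrix.det_apply', Finset.sum_apply, Finset.prod_apply]
  unfold IsPolyFun
  rw [h]
  exact sum_mem fun τ _ => mul_mem (intCast_mem _ _) (prod_mem fun i _ => hN _ _)

/-- In an affine-linear family of linear maps on a finite-dimensional space, injectivity is a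
generic property as soon as one member is injective. -/
theorem genericallyHolds_injective {M W U : Type} [AddCommGroup M] [Module ℂ M]
    [AddCommGroup W] [Module ℂ W] [FiniteDimensional ℂ W] [AddCommGroup U] [Module ℂ U]
    (T : M →ₗ[ℂ] W →ₗ[ℂ] U) (C : W →ₗ[ℂ] U) (x₀ : M)
    (h₀ : Function.Injective (T x₀ + C)) :
    GenericallyHolds fun x => Function.Injective (T x + C) := by
  obtain ⟨B, hB⟩ := (T x₀ + C).exists_leftInverse_of_injective (LinearMap.ker_eq_bot.2 h₀)
  let b := Module.finBasis ℂ W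
  refine ⟨fun x => (LinearMap.toMatrix b b (B ∘ₗ (T x + C))).det, IsPolyFun.det fun i j => ?_,
    ⟨x₀, ?_⟩, fun x hx => ?_⟩
  · have h : (fun x => LinearMap.toMatrix b b (B ∘ₗ (T x + C)) i j) =
        ⇑(b.coord i ∘ₗ B ∘ₗ T.flip (b j)) + algebraMap ℂ (M → ℂ) (b.coord i (B (C (b j)))) := by
      funext x
      simp [LinearMap.toMatrix_apply]
    unfold IsPolyFun
    rw [h]
    exact add_mem (Algebra.subset_adjoin ⟨_, rfl⟩) (Subalgebra.algebraMap_mem _ _)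
  · simp [hB]
  · replace hx : LinearMap.det (B ∘ₗ (T x + C)) ≠ 0 := by rwa [← LinearMap.det_toMatrix b]
    have hinj : Function.Injective (B ∘ₗ (T x + C)) :=
      ((LinearMap.isUnit_iff_isUnit_det _).2 (Ne.isUnit hx) |> (Module.End.isUnit_iff _).1).1
    rw [LinearMap.coe_comp] at hinj
    exact hinj.of_comp

/-- The `(j, k)` entry of the Hessian matrix at the `m`-th coordinate point, as a linear
functional. -/
def hessianAt {n : ℕ} (m j k : Fin (n + 1)) : S n →ₗ[ℂ] ℂ :=
  (aeval (Pi.single m (1 : ℂ)) : S n →ₐ[ℂ] ℂ).toLinearMap ∘ₗ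
    (pderiv k).toLinearMap ∘ₗ (pderiv j).toLinearMap

theorem hessianAt_apply {n : ℕ} (m j k : Fin (n + 1)) (f : S n) :
    hessianAt m j k f = eval (Pi.single m 1) (pderiv k (pderiv j f)) := by
  simp [hessianAt, aeval_eq_eval]

theorem hessianAt_comm {n : ℕ} (m j k : Fin (n + 1)) (f : S n) :
    hessianAt m j k f = hessianAt m k j f := by
  rw [hessianAt_apply, hessianAt_apply, pderiv_comm_apply]

/-- The antisymmetric parts of the products `A * H`, with `H` running through the Hessian matrices
of `f` at the coordinate points. -/
def hessianSkew (n d : ℕ) : homogeneousSubmodule (Fin (n + 1)) ℂ d →ₗ[ℂ]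
    Matrix (Fin (n + 1)) (Fin (n + 1)) ℂ →ₗ[ℂ]
      (Fin (n + 1) → Fin (n + 1) → Fin (n + 1) → ℂ) × ℂ :=
  LinearMap.mk₂ ℂ
    (fun f A => (fun m i k => ∑ j, A i j * hessianAt m j k (f : S n) -
      ∑ j, A k j * hessianAt m j i (f : S n), 0))
    (fun f g A => by
      ext <;> simp [mul_add, Finset.sum_add_distrib]; ring)
    (fun c f A => by
      ext <;> simp [mul_sub, Finset.mul_sum, mul_left_comm])
    (fun f A B => by
      ext <;> simp [add_mul, Finset.sum_add_distrib]; ring)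
    (fun c f A => by
      ext <;> simp [mul_sub, Finset.mul_sum, mul_assoc])

/-- The upper left entry of a matrix, placed in the last component. -/
def cornerEntry (n : ℕ) : Matrix (Fin (n + 1)) (Fin (n + 1)) ℂ →ₗ[ℂ]
    (Fin (n + 1) → Fin (n + 1) → Fin (n + 1) → ℂ) × ℂ :=
  LinearMap.inr ℂ _ ℂ ∘ₗ Matrix.entryLinearMap ℂ ℂ 0 0

theorem hessianSkew_add_cornerEntry_eq_zero_iff {n d : ℕ}
    (f : homogeneousSubmodule (Fin (n + 1)) ℂ d) (A : Matrix (Fin (n + 1)) (Fin (n + 1)) ℂ) :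
    (hessianSkew n d f + cornerEntry n) A = 0 ↔
      (∀ m i k, ∑ j, A i j * hessianAt m j k (f : S n) = ∑ j, A k j * hessianAt m j i (f : S n)) ∧
        A 0 0 = 0 := by
  simp [hessianSkew, cornerEntry, Prod.ext_iff, funext_iff, sub_eq_zero]

/-- The Fermat polynomial plus the `d`-th power of the sum of the variables. -/
def fermatPlus (n d : ℕ) : S n := ∑ i, X i ^ d + (∑ i, X i) ^ d

theorem fermatPlus_isHomogeneous (n d : ℕ) : (fermatPlus n d).IsHomogeneous d := by
  refine (IsHomogeneous.sum _ _ _ fun i _ => ?_).add ?_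
  · simpa using (isHomogeneous_X ℂ i).pow d
  · simpa using (IsHomogeneous.sum Finset.univ (fun i : Fin (n + 1) => (X i : S n)) 1
      fun i _ => isHomogeneous_X ℂ i).pow d

theorem hessianAt_fermatPlus {n d : ℕ} (hd : 3 ≤ d) (m j k : Fin (n + 1)) :
    hessianAt m j k (fermatPlus n d) =
      d * (d - 1) * ((if j = m ∧ k = m then 1 else 0) + 1) := by
  obtain ⟨e, rfl⟩ := Nat.exists_eq_add_of_le' hd
  rw [hessianAt_apply]
  have h1 : pderiv j (fermatPlus n (e + 3)) =
      C ((e + 3 : ℕ) : ℂ) * (X j ^ (e + 2) + (∑ i, X i) ^ (e + 2)) := by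
    rw [map_natCast]
    simp [fermatPlus, pderiv_X, Pi.single_apply]
    ring
  rw [h1, pderiv_C_mul]
  simp only [map_add, pderiv_pow, map_sum, pderiv_X, Pi.single_apply, map_mul, map_pow, eval_X,
    map_natCast]
  by_cases hjm : j = m <;> by_cases hkm : k = m <;> by_cases hjk : j = k <;>
    simp_all <;> first | ring1 | exact Or.inl (by ring)

theorem injective_hessianSkew_fermatPlus {n d : ℕ} (hd : 3 ≤ d) (hn : 2 ≤ n) :
    Function.Injective
      (hessianSkew n d ⟨fermatPlus n d, fermatPlus_isHomogeneous n d⟩ + cornerEntry n) := by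
  refine (injective_iff_map_eq_zero _).2 fun A hA => ?_
  obtain ⟨hsym, h00⟩ := (hessianSkew_add_cornerEntry_eq_zero_iff _ _).1 hA
  have hd0 : (d : ℂ) * (d - 1) ≠ 0 := by
    refine mul_ne_zero (by norm_cast; omega) (sub_ne_zero.2 (by norm_cast; omega))
  have hrow (m i k) : ∑ j, A i j * hessianAt m j k (fermatPlus n d) =
      d * (d - 1) * ((if k = m then A i m else 0) + ∑ j, A i j) := by
    simp only [hessianAt_fermatPlus hd]
    rw [mul_add, Finset.mul_sum]
    by_cases hk : k = m
    · simp only [hk, and_true, if_true, mul_add, mul_one, Finset.sum_add_distrib, mul_ite,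
        mul_zero, Finset.sum_ite_eq', Finset.mem_univ]
      simp only [mul_comm]
    · simp [hk, mul_comm]
  have hsym' (m i k) : (if k = m then A i m else 0) + ∑ j, A i j =
      (if i = m then A k m else 0) + ∑ j, A k j := by
    have := hsym m i k
    rw [hrow, hrow] at this
    exact mul_left_cancel₀ hd0 this
  have hsum (i k) : ∑ j, A i j = ∑ j, A k j := by
    obtain ⟨m, hm⟩ : ∃ m, m ∉ ({i, k} : Finset (Fin (n + 1))) := by
      by_contra! h
      have := (Finset.card_le_card (fun m _ => h m : Finset.univ ⊆ _)).trans Finset.card_le_two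
      simp at this
      omega
    simp only [Finset.mem_insert, Finset.mem_singleton, not_or] at hm
    simpa [Ne.symm hm.1, Ne.symm hm.2] using hsym' m i k
  have hoff (i k) (hik : i ≠ k) : A i k = 0 := by
    simpa [hik, hsum i k] using hsym' k i k
  have hdiag (i) : ∑ j, A i j = A i i :=
    Finset.sum_eq_single i (fun j _ hj => hoff i j hj.symm) (by simp)
  ext i k
  by_cases hik : i = k
  · subst hik
    rw [← hdiag, hsum i 0, hdiag, h00, Matrix.zero_apply]
  · rw [hoff i k hik, Matrix.zero_apply]

/-- If `g` is smooth and its gradient is proportional to that of `f`, then `f` is a multiple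
of `g`. -/
theorem exists_eq_smul_of_pderiv_eq_smul {n d : ℕ} (hd : d ≠ 0) {f g : S n}
    (hf : f.IsHomogeneous d) (hg : g.IsHomogeneous d) (hsm : SmoothHyp g) {c : ℂ}
    (h : ∀ i, pderiv i g = c • pderiv i f) : ∃ μ : ℂ, f = μ • g := by
  have hc : c ≠ 0 := by
    rintro rfl
    have := hsm (fun _ => 1) fun i => by simp [h]
    exact one_ne_zero (congrFun this 0)
  refine ⟨c⁻¹, ?_⟩
  have key : (d : ℕ) • g = d • (c • f) := by
    rw [← hg.sum_X_mul_pderiv, smul_comm, ← hf.sum_X_mul_pderiv, Finset.smul_sum]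
    exact Finset.sum_congr rfl fun i _ => by rw [h, mul_smul_comm]
  rw [smul_right_injective _ hd key, smul_smul, inv_mul_cancel₀ hc, one_smul]

/-- Mather–Yau variant.
For `d ≥ 4`, `n ≥ 4` and generic `f ∈ S^d`: if `g ∈ S^d` defines a smooth hypersurface
and `J_f = J_g` as ideals, then `f = μ·g` for some scalar `μ`. -/
theorem generic_mather_yau (n d : ℕ) (hd : 4 ≤ d) (hn : 4 ≤ n) :
    GenericallyHolds (fun f : MvPolynomial.homogeneousSubmodule (Fin (n + 1)) ℂ d =>
      ∀ g : S n, g.IsHomogeneous d → SmoothHyp g →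
        jacobianIdeal (f : S n) = jacobianIdeal g →
        ∃ μ : ℂ, (f : S n) = μ • g) := by
  obtain ⟨φ, hφ, hne, hinj⟩ := genericallyHolds_injective (hessianSkew n d) (cornerEntry n) _
    (injective_hessianSkew_fermatPlus (n := n) (d := d) (by omega) (by omega))
  refine ⟨φ, hφ, hne, fun f hf g hg hsm hJ => ?_⟩
  have hfh : (f : S n).IsHomogeneous d := f.2
  have hlin (i) : ∃ a : Fin (n + 1) → ℂ, pderiv i g = ∑ j, a j • pderiv j (f : S n) :=
    exists_sum_smul_of_mem_span_homogeneous (fun j => hfh.pderiv) hg.pderiv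
      (show pderiv i g ∈ jacobianIdeal (f : S n) from
        hJ ▸ Ideal.subset_span (Set.mem_range_self i))
  choose A hA using hlin
  have hAH (m i k) : ∑ j, A i j * hessianAt m j k (f : S n) = hessianAt m i k g := by
    simp [hessianAt_apply, hA, smul_eval]
  let D : Matrix (Fin (n + 1)) (Fin (n + 1)) ℂ := Matrix.of A - A 0 0 • 1
  have hDH (m i k) : ∑ j, D i j * hessianAt m j k (f : S n) =
      hessianAt m i k g - A 0 0 * hessianAt m i k (f : S n) := by
    simp [D, sub_mul, Finset.sum_sub_distrib, hAH, Matrix.one_apply]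
  have hD : D = 0 := by
    refine (injective_iff_map_eq_zero _).1 (hinj f hf) D
      ((hessianSkew_add_cornerEntry_eq_zero_iff _ _).2 ⟨fun m i k => ?_, by simp [D]⟩)
    rw [hDH, hDH, hessianAt_comm m i k, hessianAt_comm m i k]
  refine exists_eq_smul_of_pderiv_eq_smul (by omega) hfh hg hsm (c := A 0 0) fun i => ?_
  have hAi (j) : A i j = if i = j then A 0 0 else 0 := by
    have := congrFun (congrFun hD i) j
    simpa [D, sub_eq_zero, Matrix.one_apply] using this
  simp [hA, hAi]

end
end

section
/- Let d ≥ 4 and n ≥ 4. For generic f ∈ S^d the following holds: if g ∈ S^d defines a smooth hypersurface X_g ⊂ P^n and there exists a linear isomorphism i : R_f^d → R_g^d mapping the set of first-order Schiffer variations of f onto the set of first-order Schiffer variations of g (i.e., i({x^d mod J_f : x ∈ S^1}) = {y^d mod J_g : y ∈ S^1}), then X_f is isomorphic to X_g: there exist A ∈ GL(n+1, ℂ) and λ ∈ ℂ* such that g(X) = λ·f(A·X). -/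
open MvPolynomial

noncomputable section

/-- Exponent vectors of total degree `m`. -/
abbrev expo (n m : ℕ) : Finset (Fin (n + 1) →₀ ℕ) := Finset.univ.finsuppAntidiag m

lemma mem_expo {n m : ℕ} {e : Fin (n + 1) →₀ ℕ} : e ∈ expo n m ↔ e.degree = m := by
  simp [expo, Finsupp.degree_eq_sum]

/-- The linear form with coefficient vector `c`. -/
def lin {n : ℕ} (c : Fin (n + 1) → ℂ) : S n := ∑ i, c i • X i

lemma isHomogeneous_lin {n : ℕ} (c : Fin (n + 1) → ℂ) : (lin c).IsHomogeneous 1 :=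
  (homogeneousSubmodule _ ℂ 1).sum_mem fun i _ =>
    Submodule.smul_mem _ _ (isHomogeneous_X ℂ i)

lemma isHomogeneous_lin_pow {n : ℕ} (c : Fin (n + 1) → ℂ) (d : ℕ) :
    (lin c ^ d).IsHomogeneous d := by
  simpa using (isHomogeneous_lin c).pow d

lemma lin_smul {n : ℕ} (t : ℂ) (c : Fin (n + 1) → ℂ) : lin (t • c) = t • lin c := by
  simp [lin, Finset.smul_sum, smul_smul]

lemma exists_eq_lin {n : ℕ} {x : S n} (hx : x.IsHomogeneous 1) : ∃ c, x = lin c := by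
  have h : x ∈ Submodule.span ℂ (Set.range (X : Fin (n + 1) → S n)) := by
    rw [← homogeneousSubmodule_one_eq_span_X]; exact hx
  obtain ⟨c, rfl⟩ := (Submodule.mem_span_range_iff_exists_fun ℂ).1 h
  exact ⟨c, rfl⟩

lemma eq_sum_expo {n d : ℕ} {h : S n} (hh : h.IsHomogeneous d) :
    h = ∑ m ∈ expo n d, coeff m h • monomial m 1 := by
  conv_lhs => rw [h.as_sum]
  rw [Finset.sum_subset (s₂ := expo n d)]
  · simp [smul_monomial]
  · intro m hm
    by_contra hne
    exact (mem_support_iff.1 hm) (hh.coeff_eq_zero fun h' => hne (mem_expo.2 h'))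
  · intro m _ hm
    simp [notMem_support_iff.1 hm]

/-- The degree `d` polynomial `c ↦ a ((lin c) ^ d)` associated with a linear functional `a`. -/
def polar {n : ℕ} (d : ℕ) (a : S n →ₗ[ℂ] ℂ) : S n :=
  ∑ m ∈ expo n d, monomial m ((m.multinomial : ℂ) * a (monomial m 1))

lemma isHomogeneous_polar {n d : ℕ} (a : S n →ₗ[ℂ] ℂ) : (polar d a).IsHomogeneous d :=
  (homogeneousSubmodule _ ℂ d).sum_mem fun _ hm => isHomogeneous_monomial _ (mem_expo.1 hm)

lemma coeff_polar {n d : ℕ} (a : S n →ₗ[ℂ] ℂ) (m : Fin (n + 1) →₀ ℕ) :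
    coeff m (polar d a) =
      if m.degree = d then (m.multinomial : ℂ) * a (monomial m 1) else 0 := by
  classical
  simp only [polar, coeff_sum, coeff_monomial, Finset.sum_ite_eq', mem_expo]

lemma eval_polar {n d : ℕ} (a : S n →ₗ[ℂ] ℂ) (c : Fin (n + 1) → ℂ) :
    eval c (polar d a) = a (lin c ^ d) := by
  rw [eq_sum_expo (isHomogeneous_lin_pow c d), map_sum, polar, map_sum]
  refine Finset.sum_congr rfl fun m hm => ?_
  have hd : m.sum (fun _ k => k) = d := mem_expo.1 hm
  rw [map_smul, lin, coeff_linearCombination_X_pow_of_fintype, if_pos hd, eval_monomial,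
    smul_eq_mul]
  ring

lemma multinomial_ne_zero {n : ℕ} (m : Fin (n + 1) →₀ ℕ) : (m.multinomial : ℂ) ≠ 0 := by
  have := Nat.multinomial_pos m.support m
  rw [Finsupp.multinomial_eq]
  exact_mod_cast this.ne'

/-- The powers of linear forms span the homogeneous polynomials. -/
lemma eq_of_forall_lin_pow {n d : ℕ} {a b : S n →ₗ[ℂ] ℂ}
    (hab : ∀ c, a (lin c ^ d) = b (lin c ^ d)) {h : S n} (hh : h.IsHomogeneous d) :
    a h = b h := by
  have hp : polar d a = polar d b := MvPolynomial.funext fun c => by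
    rw [eval_polar, eval_polar, hab]
  rw [eq_sum_expo hh, map_sum, map_sum]
  refine Finset.sum_congr rfl fun m hm => ?_
  have h1 := congrArg (coeff m) hp
  rw [coeff_polar, coeff_polar, if_pos (mem_expo.1 hm), if_pos (mem_expo.1 hm)] at h1
  rw [map_smul, map_smul, mul_left_cancel₀ (multinomial_ne_zero m) h1]

lemma totalDegree_pow_of_ne_zero {n : ℕ} {p : S n} (hp : p ≠ 0) (m : ℕ) :
    (p ^ m).totalDegree = m * p.totalDegree := by
  induction m with
  | zero => simp
  | succ m ih =>
    rw [pow_succ, totalDegree_mul_of_isDomain (pow_ne_zero _ hp) hp, ih]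
    ring

/-- A family of degree `m` forms `q i` behaving like the `m`-th powers of coordinates is, up to a
common constant, the family of `m`-th powers of linear forms. -/
theorem exists_linear_of_powers {n m : ℕ} (hn : 1 ≤ n) (hm : 1 ≤ m) (q r : Fin (n + 1) → S n)
    (hq : ∀ i, (q i).IsHomogeneous m) (hq0 : ∀ i, q i ≠ 0)
    (hr0 : r 0 = q 0) (hr : ∀ i, r i ^ m = q 0 ^ (m - 1) * q i)
    (hnp : ∀ i j, i ≠ j → ∀ α β : ℂ, α ≠ 0 → C α * q i ≠ C β * q j) :
    ∃ (κ : ℂ) (p : Fin (n + 1) → S n), κ ≠ 0 ∧ (∀ i, (p i).IsHomogeneous 1) ∧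
      (∀ i, p i ≠ 0) ∧
      (∀ i, q i = C κ * p i ^ m) ∧ ∀ i, r i = C κ * p 0 ^ (m - 1) * p i := by
  classical
  let := Classical.choice (inferInstance : Nonempty (NormalizedGCDMonoid (S n)))
  obtain ⟨p, hp, hgcd⟩ := Finset.univ.extract_gcd r Finset.univ_nonempty
  set G := Finset.univ.gcd r with hG
  replace hp : ∀ i, r i = G * p i := fun i => hp i (Finset.mem_univ i)
  have hm0 : m ≠ 0 := by omega
  have hG0 : G ≠ 0 := by
    intro h
    apply hq0 0
    rw [← hr0, hp, h, zero_mul]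
  have key : ∀ i, G * p i ^ m = p 0 ^ (m - 1) * q i := by
    intro i
    have h1 := hr i
    rw [hp i, ← hr0, hp 0, mul_pow, mul_pow] at h1
    apply mul_left_cancel₀ (pow_ne_zero (m - 1) hG0)
    calc _ = G ^ (m - 1) * G * p i ^ m := by ring
      _ = G ^ m * p i ^ m := by rw [← pow_succ, Nat.sub_add_cancel hm]
      _ = _ := by rw [h1]; ring
  have hcop : IsUnit (Finset.univ.gcd fun i => p i ^ m) := by
    by_contra hu
    have hne : (Finset.univ.gcd fun i => p i ^ m) ≠ 0 := by
      intro h0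
      have h0 := Finset.gcd_eq_zero_iff.1 h0 0 (Finset.mem_univ 0)
      have := key 0
      rw [h0, mul_zero] at this
      have h3 : p 0 = 0 := pow_eq_zero_iff hm0 |>.1 h0
      apply hq0 0
      rw [← hr0, hp, h3, mul_zero]
    obtain ⟨π, hπ, hdvd⟩ := WfDvdMonoid.exists_irreducible_factor hu hne
    have h4 : π ∣ Finset.univ.gcd p := Finset.dvd_gcd fun i _ =>
      hπ.prime.dvd_of_dvd_pow (hdvd.trans (Finset.gcd_dvd (Finset.mem_univ i)))
    rw [hgcd] at h4
    exact hπ.not_isUnit (isUnit_of_dvd_one h4)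
  have hdvd : p 0 ^ (m - 1) ∣ G := by
    have h5 : p 0 ^ (m - 1) ∣ Finset.univ.gcd fun i => G * p i ^ m :=
      Finset.dvd_gcd fun i _ => ⟨q i, key i⟩
    have h6 := h5.trans (Finset.gcd_mul_left' Finset.univ (fun i => p i ^ m) G).dvd
    exact (hcop.dvd_mul_right).1 h6
  obtain ⟨K, hK⟩ := hdvd
  have hp00 : p 0 ≠ 0 := by
    intro h
    apply hq0 0
    rw [← hr0, hp, h, mul_zero]
  have hqK : ∀ i, q i = K * p i ^ m := by
    intro i
    have := key i
    rw [hK, mul_assoc] at this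
    exact (mul_left_cancel₀ (pow_ne_zero _ hp00) this).symm
  have hK0 : K ≠ 0 := by
    rintro rfl
    exact hq0 0 (by rw [hqK, zero_mul])
  have hpi0 : ∀ i, p i ≠ 0 := by
    intro i h
    exact hq0 i (by rw [hqK, h, zero_pow hm0, mul_zero])
  have htd : ∀ i, K.totalDegree + m * (p i).totalDegree = m := by
    intro i
    have h7 := (hq i).totalDegree (hq0 i)
    rw [hqK, totalDegree_mul_of_isDomain hK0 (pow_ne_zero _ (hpi0 i)),
      totalDegree_pow_of_ne_zero (hpi0 i)] at h7
    exact h7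
  by_cases hKd : K.totalDegree = 0
  · obtain ⟨κ, rfl⟩ : ∃ κ, K = C κ := ⟨_, totalDegree_eq_zero_iff_eq_C.1 hKd⟩
    have hκ : κ ≠ 0 := by rintro rfl; simp at hK0
    refine ⟨κ, p, hκ, fun i => ?_, hpi0, hqK, fun i => ?_⟩
    · have h1 : (p i).totalDegree = 1 := by
        have := htd i
        rw [hKd, zero_add] at this
        exact (mul_eq_left₀ hm0).1 this
      have h2 : coeff 0 (p i) = 0 := by
        have h3 := congrArg constantCoeff (hqK i)
        rw [map_mul, map_pow, constantCoeff_C, constantCoeff_eq,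
          (hq i).coeff_eq_zero (by simpa using hm0.symm)] at h3
        have h4 := (mul_eq_zero.1 h3.symm).resolve_left hκ
        exact pow_eq_zero_iff hm0 |>.1 h4
      have h3 := sum_homogeneousComponent (p i)
      rw [h1, Finset.sum_range_succ, Finset.sum_range_one, homogeneousComponent_zero, h2, C_0,
        zero_add] at h3
      rw [← h3]
      exact homogeneousComponent_isHomogeneous 1 _
    · rw [hp, hK]; ring
  · exfalso
    have hc : ∀ i, ∃ α : ℂ, α ≠ 0 ∧ p i = C α := by
      intro i
      have h1 : (p i).totalDegree = 0 := by
        have := htd i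
        by_contra h0
        have : m ≤ m * (p i).totalDegree := Nat.le_mul_of_pos_right m (by omega)
        omega
      refine ⟨_, ?_, totalDegree_eq_zero_iff_eq_C.1 h1⟩
      intro h0
      apply hpi0 i
      rw [totalDegree_eq_zero_iff_eq_C.1 h1, h0, C_0]
    obtain ⟨α, hα, hα'⟩ := hc 0
    obtain ⟨β, hβ, hβ'⟩ := hc ⟨1, by omega⟩
    refine hnp 0 ⟨1, by omega⟩ (by simp [Fin.ext_iff]) (β ^ m) (α ^ m) (pow_ne_zero _ hβ) ?_
    rw [hqK, hqK, hα', hβ', ← C_pow, ← C_pow]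
    ring

/-- The derivation `X_j ∂/∂X_i` attached to `q = (i, j)`, as a linear map. -/
def jac {n : ℕ} (q : Fin (n + 1) × Fin (n + 1)) : S n →ₗ[ℂ] S n :=
  LinearMap.mulLeft ℂ (X q.2) ∘ₗ (pderiv q.1 : Derivation ℂ (S n) (S n)).toLinearMap

lemma jac_apply {n : ℕ} (q : Fin (n + 1) × Fin (n + 1)) (f : S n) :
    jac q f = X q.2 * pderiv q.1 f := rfl

/-- The degree `d` piece of the Jacobian ideal of a form of degree `d`. -/
def jacPiece {n : ℕ} (f : S n) : Submodule ℂ (S n) :=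
  Submodule.span ℂ (Set.range fun q => jac q f)

/-- Every monomial of degree `k * d` is a combination of products of `k` forms orthogonal to
`jacPiece f`. -/
def PowersSpan {n : ℕ} (d k : ℕ) (f : S n) : Prop :=
  ∀ e : Fin (n + 1) →₀ ℕ, e.degree = k * d → monomial e 1 ∈ Submodule.span ℂ
    {P : S n | ∃ a : Fin k → (S n →ₗ[ℂ] ℂ), (∀ r q, a r (jac q f) = 0) ∧
      P = ∏ r, polar d (a r)}

/-- The only forms whose linear deformations lie in `jacPiece f` are the multiples of `f`. -/
def Rigid {n : ℕ} (d : ℕ) (f : S n) : Prop :=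
  ∀ g : S n, g.IsHomogeneous d → (∀ p, jac p g ∈ jacPiece f) → ∃ t : ℂ, g = t • f

lemma isHomogeneous_jac {n d : ℕ} (hd : 1 ≤ d) {f : S n} (hf : f.IsHomogeneous d)
    (q : Fin (n + 1) × Fin (n + 1)) : (jac q f).IsHomogeneous d := by
  have := (isHomogeneous_X ℂ q.2).mul (hf.pderiv (i := q.1))
  rwa [Nat.add_sub_cancel' hd] at this

lemma jac_mem_jacobianIdeal {n : ℕ} (f : S n) (q : Fin (n + 1) × Fin (n + 1)) :
    jac q f ∈ jacobianIdeal f :=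
  Ideal.mul_mem_left _ _ (Ideal.subset_span ⟨q.1, rfl⟩)

lemma homogeneousComponent_mul_of_isHomogeneous_s6 {n e : ℕ} (k : ℕ) (p : S n) {q : S n}
    (hq : q.IsHomogeneous e) :
    homogeneousComponent (k + e) (p * q) = homogeneousComponent k p * q := by
  conv_lhs => rw [← sum_homogeneousComponent p, Finset.sum_mul, map_sum]
  have h : ∀ i, homogeneousComponent (k + e) (homogeneousComponent i p * q) =
      if i = k then homogeneousComponent k p * q else 0 := by
    intro i
    rw [homogeneousComponent_of_mem ((homogeneousComponent_isHomogeneous i p).mul hq)]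
    by_cases h : i = k
    · simp [h]
    · rw [if_neg h, if_neg (by omega)]
  simp only [h, Finset.sum_ite_eq']
  split_ifs with hk
  · rfl
  · rw [homogeneousComponent_eq_zero, zero_mul]
    simpa using hk

lemma homogeneousComponent_mem_jacPiece {n d : ℕ} (hd : 1 ≤ d) {f : S n}
    (hf : f.IsHomogeneous d) {h : S n} (hh : h ∈ jacobianIdeal f) :
    homogeneousComponent d h ∈ jacPiece f := by
  obtain ⟨s, rfl⟩ := Ideal.mem_span_range_iff_exists_fun.1 hh
  rw [map_sum]
  refine Submodule.sum_mem _ fun i _ => ?_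
  have h1 := homogeneousComponent_mul_of_isHomogeneous_s6 1 (s i) (hf.pderiv (i := i))
  rw [Nat.add_sub_cancel' hd] at h1
  obtain ⟨c, hc⟩ := exists_eq_lin (homogeneousComponent_isHomogeneous 1 (s i))
  rw [h1, hc, lin, Finset.sum_mul]
  refine Submodule.sum_mem _ fun j _ => ?_
  rw [smul_mul_assoc]
  exact Submodule.smul_mem _ _ (Submodule.subset_span ⟨(i, j), rfl⟩)

/-- The quotient map of the Jacobian ring as a `ℂ`-linear map. -/
abbrev quotMap {n : ℕ} (f : S n) : S n →ₗ[ℂ] S n ⧸ jacobianIdeal f :=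
  (Ideal.Quotient.mkₐ ℂ (jacobianIdeal f)).toLinearMap

lemma quotMap_eq_zero {n : ℕ} {f h : S n} : quotMap f h = 0 ↔ h ∈ jacobianIdeal f :=
  Ideal.Quotient.eq_zero_iff_mem

lemma exists_descend {n d : ℕ} (hd : 1 ≤ d) {f : S n} (hf : f.IsHomogeneous d)
    (a : S n →ₗ[ℂ] ℂ) (ha : ∀ q, a (jac q f) = 0) :
    ∃ b : (S n ⧸ jacobianIdeal f) →ₗ[ℂ] ℂ,
      ∀ h : S n, h.IsHomogeneous d → b (quotMap f h) = a h := by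
  obtain ⟨s, hs⟩ := (quotMap f).exists_rightInverse_of_surjective
    (LinearMap.range_eq_top.2 (Ideal.Quotient.mkₐ_surjective ℂ _))
  refine ⟨a ∘ₗ homogeneousComponent d ∘ₗ s, fun h hh => ?_⟩
  have h1 : s (quotMap f h) - h ∈ jacobianIdeal f := by
    rw [← quotMap_eq_zero, map_sub, sub_eq_zero]
    exact LinearMap.congr_fun hs _
  have h2 := homogeneousComponent_mem_jacPiece hd hf h1
  have h3 : jacPiece f ≤ LinearMap.ker a := by
    rw [jacPiece, Submodule.span_le]
    rintro _ ⟨q, rfl⟩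
    exact ha q
  have h4 := h3 h2
  rw [LinearMap.mem_ker, map_sub, map_sub, sub_eq_zero, homogeneousComponent_eq_self hh] at h4
  exact h4

section Transfer

variable {n d k : ℕ} {f : S n}

lemma exists_transfer (hd : 1 ≤ d) (hf : f.IsHomogeneous d) (hP : PowersSpan d k f)
    (T : S n →ₗ[ℂ] S n ⧸ jacobianIdeal f) {e : Fin (n + 1) →₀ ℕ} (he : e.degree = k * d) :
    ∃ Q : S n, Q.IsHomogeneous (k * d) ∧
      ∀ c y, quotMap f (lin c ^ d) = T (lin y ^ d) →
        eval c (monomial e 1) = eval y Q := by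
  refine Submodule.span_induction (p := fun P _ => ∃ Q : S n, Q.IsHomogeneous (k * d) ∧
      ∀ c y, quotMap f (lin c ^ d) = T (lin y ^ d) → eval c P = eval y Q) ?_ ?_ ?_ ?_ (hP e he)
  · rintro _ ⟨a, ha, rfl⟩
    choose b hb using fun r => exists_descend hd hf (a r) (ha r)
    refine ⟨∏ r, polar d (b r ∘ₗ T), ?_, fun c y h => ?_⟩
    · have := IsHomogeneous.prod Finset.univ (fun r => polar d (b r ∘ₗ T)) (fun _ => d)
        fun r _ => isHomogeneous_polar _
      simpa using this
    · rw [map_prod, map_prod]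
      refine Finset.prod_congr rfl fun r _ => ?_
      rw [eval_polar, eval_polar, ← hb r _ (isHomogeneous_lin_pow c d), h]
      rfl
  · exact ⟨0, isHomogeneous_zero _ _ _, fun c y _ => by simp⟩
  · rintro P₁ P₂ - - ⟨Q₁, h₁, h₁'⟩ ⟨Q₂, h₂, h₂'⟩
    exact ⟨Q₁ + Q₂, h₁.add h₂, fun c y h => by rw [map_add, map_add, h₁' c y h, h₂' c y h]⟩
  · rintro t P - ⟨Q, h₁, h₁'⟩
    exact ⟨t • Q, (homogeneousSubmodule _ ℂ _).smul_mem t h₁, fun c y h => by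
      rw [smul_eval, smul_eval, h₁' c y h]⟩

lemma eval_lin (c y : Fin (n + 1) → ℂ) : eval y (lin c) = ∑ i, c i * y i := by
  simp [lin]

lemma substLin_lin (M : Matrix (Fin (n + 1)) (Fin (n + 1)) ℂ) (y : Fin (n + 1) → ℂ) :
    substLin M.transpose (lin y) = lin (M.mulVec y) := by
  simp only [substLin, lin, map_sum, map_smul, aeval_X, Matrix.mulVec, dotProduct,
    Matrix.transpose_apply, Finset.smul_sum, Finset.sum_smul, smul_smul]
  rw [Finset.sum_comm]
  simp only [mul_comm]

/-- `substLin` as an algebra homomorphism. -/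
def substHom (M : Matrix (Fin (n + 1)) (Fin (n + 1)) ℂ) : S n →ₐ[ℂ] S n :=
  aeval (fun i => ∑ j, M i j • X j)

lemma substHom_apply (M : Matrix (Fin (n + 1)) (Fin (n + 1)) ℂ) (p : S n) :
    substHom M p = substLin M p := rfl

lemma exists_scalar (F : Finset ℂ) (p : S n) (hp : p ≠ 0)
    (M : Matrix (Fin (n + 1)) (Fin (n + 1)) ℂ) (T : S n →ₗ[ℂ] S n ⧸ jacobianIdeal f)
    (hT : ∀ y, eval y p ≠ 0 →
      ∃ ζ ∈ F, T (lin y ^ d) = ζ • quotMap f (lin (M.mulVec y) ^ d)) :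
    ∃ ζ ∈ F, ∀ y, T (lin y ^ d) = ζ • quotMap f (lin (M.mulVec y) ^ d) := by
  by_contra! hcon
  have hpol : ∀ ζ ∈ F, ∃ D : S n, D ≠ 0 ∧
      ∀ y, T (lin y ^ d) = ζ • quotMap f (lin (M.mulVec y) ^ d) → eval y D = 0 := by
    intro ζ hζ
    obtain ⟨y, hy⟩ := hcon ζ hζ
    rw [← sub_ne_zero] at hy
    obtain ⟨a, ha⟩ : ∃ a : Module.Dual ℂ (S n ⧸ jacobianIdeal f),
        a (T (lin y ^ d) - ζ • quotMap f (lin (M.mulVec y) ^ d)) ≠ 0 := by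
      by_contra! h
      exact hy ((Module.forall_dual_apply_eq_zero_iff ℂ _).1 h)
    have hev : ∀ y, eval y (polar d (a ∘ₗ T) -
        C ζ * polar d (a ∘ₗ quotMap f ∘ₗ (substHom M.transpose).toLinearMap)) =
        a (T (lin y ^ d) - ζ • quotMap f (lin (M.mulVec y) ^ d)) := by
      intro y
      have h1 : (substHom M.transpose).toLinearMap (lin y ^ d) = lin (M.mulVec y) ^ d := by
        rw [AlgHom.toLinearMap_apply, map_pow, substHom_apply, substLin_lin]
      rw [map_sub, map_mul, eval_polar, eval_polar, eval_C, map_sub, map_smul, smul_eq_mul,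
        LinearMap.comp_apply, LinearMap.comp_apply, LinearMap.comp_apply, h1]
    refine ⟨polar d (a ∘ₗ T) -
        C ζ * polar d (a ∘ₗ quotMap f ∘ₗ (substHom M.transpose).toLinearMap),
      fun h0 => ha ?_, fun y hy => ?_⟩
    · rw [← hev, h0, map_zero]
    · rw [hev, hy, sub_self, map_zero]
  choose! D hD hD' using hpol
  have hne : p * ∏ ζ ∈ F, D ζ ≠ 0 := mul_ne_zero hp (Finset.prod_ne_zero_iff.2 hD)
  refine hne (MvPolynomial.funext fun y => ?_)
  rw [map_mul, map_prod, map_zero]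
  by_cases hy : eval y p = 0
  · rw [hy, zero_mul]
  · obtain ⟨ζ, hζ, h⟩ := hT y hy
    rw [Finset.prod_eq_zero hζ (hD' ζ hζ y h), mul_zero]

/-- A linear map identifying the sets of `d`-th powers is induced by a linear substitution. -/
theorem exists_matrix (hd : 1 ≤ d) (hn : 1 ≤ n) (hk : 1 ≤ k) (hf : f.IsHomogeneous d)
    (hP : PowersSpan d k f) (T : S n →ₗ[ℂ] S n ⧸ jacobianIdeal f)
    (hex : ∀ y, ∃ c, quotMap f (lin c ^ d) = T (lin y ^ d))
    (hsurj : ∀ c, ∃ y, quotMap f (lin c ^ d) = T (lin y ^ d)) :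
    ∃ M : Matrix (Fin (n + 1)) (Fin (n + 1)) ℂ, Function.Surjective M.mulVec ∧
      ∀ y, T (lin y ^ d) = quotMap f (lin (M.mulVec y) ^ d) := by
  have hkd : 1 ≤ k * d := Nat.mul_pos hk hd
  have hdeg : ∀ i j : Fin (n + 1),
      (Finsupp.single i (k * d - 1) + Finsupp.single j 1).degree = k * d := by
    intro i j
    rw [map_add, Finsupp.degree_single, Finsupp.degree_single, Nat.sub_add_cancel hkd]
  choose Q hQ hQ' using fun i j => exists_transfer hd hf hP T (hdeg i j)
  have hev : ∀ c y, quotMap f (lin c ^ d) = T (lin y ^ d) → ∀ i j,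
      eval y (Q i j) = c i ^ (k * d - 1) * c j := by
    intro c y h i j
    rw [← hQ' i j c y h, eval_monomial, one_mul, Finsupp.prod_add_index' (by simp)
      (by intros; rw [pow_add]), Finsupp.prod_single_index (by simp),
      Finsupp.prod_single_index (by simp), pow_one]
  have hpow : ∀ z : ℂ, z ^ (k * d - 1) * z = z ^ (k * d) := fun z => by
    rw [← pow_succ, Nat.sub_add_cancel hkd]
  obtain ⟨κ, p, hκ, hp1, hp0, hqp, hrp⟩ := exists_linear_of_powers (m := k * d) hn hkd
    (fun i => Q i i) (fun i => Q 0 i) (fun i => hQ i i)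
    (fun i h0 => by
      obtain ⟨y, hy⟩ := hsurj (fun _ => 1)
      have h1 := hev _ y hy i i
      have h0 : Q i i = 0 := h0
      rw [h0] at h1
      simp at h1) rfl
    (fun i => MvPolynomial.funext fun y => by
      obtain ⟨c, hc⟩ := hex y
      simp only [map_mul, map_pow, hev c y hc, hpow]
      rw [mul_pow, ← pow_mul, ← pow_mul, mul_comm (k * d)])
    (fun i j hij α β hα h => by
      obtain ⟨y, hy⟩ := hsurj (Pi.single i 1)
      have h1 := congrArg (eval y) h
      simp only [map_mul, eval_C, hev _ y hy, hpow] at h1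
      rw [Pi.single_eq_same, Pi.single_eq_of_ne hij.symm, one_pow, zero_pow (by omega)] at h1
      simp at h1
      exact hα h1)
  choose P hPp using fun i => exists_eq_lin (hp1 i)
  let M₀ : Matrix (Fin (n + 1)) (Fin (n + 1)) ℂ := Matrix.of P
  have hM₀ : ∀ y i, eval y (p i) = M₀.mulVec y i := by
    intro y i
    rw [hPp, eval_lin]
    rfl
  obtain ⟨ζ, hζ, hT⟩ := exists_scalar (d := d) (Polynomial.nthRoots k κ).toFinset (p 0) (hp0 0)
    M₀ T (by
      intro y hy
      obtain ⟨c, hc⟩ := hex y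
      have h0 : c 0 ^ (k * d) = κ * eval y (p 0) ^ (k * d) := by
        have := congrArg (eval y) (hqp 0)
        simp only [hev c y hc, map_mul, map_pow, eval_C, hpow] at this
        exact this
      have hi : ∀ i, c 0 ^ (k * d - 1) * c i = κ * eval y (p 0) ^ (k * d - 1) * eval y (p i) := by
        intro i
        have := congrArg (eval y) (hrp i)
        simp only [hev c y hc, map_mul, map_pow, eval_C] at this
        exact this
      have hc0 : c 0 ≠ 0 := by
        intro h
        rw [h, zero_pow (by omega)] at h0
        exact mul_ne_zero hκ (pow_ne_zero _ hy) h0.symm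
      set τ := c 0 / eval y (p 0) with hτ
      have hcτ : c = τ • M₀.mulVec y := by
        funext i
        rw [Pi.smul_apply, ← hM₀, smul_eq_mul, hτ]
        apply mul_left_cancel₀ (pow_ne_zero (k * d - 1) hc0)
        rw [hi i]
        have h1 : c 0 ^ (k * d - 1) * (c 0 / eval y (p 0) * eval y (p i)) =
            c 0 ^ (k * d) / eval y (p 0) * eval y (p i) := by
          rw [← hpow (c 0)]; ring
        rw [h1, h0, ← hpow (eval y (p 0))]
        field_simp
      refine ⟨τ ^ d, ?_, ?_⟩
      · rw [Multiset.mem_toFinset, Polynomial.mem_nthRoots (by omega), ← pow_mul, mul_comm d k, hτ,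
          div_pow, h0, mul_div_assoc, div_self (pow_ne_zero _ hy), mul_one]
      · rw [← hc]
        conv_lhs => rw [hcτ]
        rw [lin_smul, smul_pow, map_smul])
  obtain ⟨η, hη⟩ := IsAlgClosed.exists_pow_nat_eq ζ (by omega : 0 < d)
  have hTM : ∀ y, T (lin y ^ d) = quotMap f (lin ((η • M₀).mulVec y) ^ d) := by
    intro y
    rw [hT, Matrix.smul_mulVec, lin_smul, smul_pow, map_smul, hη]
  refine ⟨η • M₀, fun c => ?_, hTM⟩
  by_cases hc : c = 0
  · exact ⟨0, by rw [hc, Matrix.mulVec_zero]⟩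
  obtain ⟨i, hi⟩ := Function.ne_iff.1 hc
  obtain ⟨y, hy⟩ := hsurj c
  set v := (η • M₀).mulVec y with hv
  have h1 : ∀ j, c i ^ (k * d - 1) * c j = v i ^ (k * d - 1) * v j := fun j => by
    rw [← hev c y hy, ← hev v y (hTM y).symm]
  have hvi : v i ≠ 0 := by
    intro h
    have := h1 i
    rw [h, mul_zero, hpow] at this
    exact pow_ne_zero _ hi this
  refine ⟨(c i / v i) • y, ?_⟩
  rw [Matrix.mulVec_smul, ← hv]
  funext j
  apply mul_left_cancel₀ (pow_ne_zero (k * d - 1) hi)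
  rw [h1 j, Pi.smul_apply, smul_eq_mul]
  have h2 := h1 i
  rw [hpow, hpow] at h2
  have h3 : c i ^ (k * d - 1) * (c i / v i * v j) = c i ^ (k * d) / v i * v j := by
    rw [← hpow (c i)]; ring
  rw [h3, h2, ← hpow (v i)]
  field_simp

end Transfer

lemma substHom_X {n : ℕ} (M : Matrix (Fin (n + 1)) (Fin (n + 1)) ℂ) (i : Fin (n + 1)) :
    substHom M (X i) = ∑ j, M i j • X j := by
  simp [substHom]

lemma substHom_comp {n : ℕ} (M N : Matrix (Fin (n + 1)) (Fin (n + 1)) ℂ) (p : S n) :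
    substHom M (substHom N p) = substHom (N * M) p := by
  have : (substHom M).comp (substHom N) = substHom (N * M) := by
    refine algHom_ext fun i => ?_
    simp only [AlgHom.comp_apply, substHom_X, map_sum, map_smul, Finset.smul_sum, smul_smul,
      Matrix.mul_apply, Finset.sum_smul]
    rw [Finset.sum_comm]
  exact DFunLike.congr_fun this p

lemma substHom_one {n : ℕ} (p : S n) : substHom 1 p = p := by
  have : (substHom 1 : S n →ₐ[ℂ] S n) = AlgHom.id ℂ _ := by
    refine algHom_ext fun i => ?_
    simp [substHom_X, Matrix.one_apply]
  exact DFunLike.congr_fun this p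

lemma isHomogeneous_substHom {n d : ℕ} (M : Matrix (Fin (n + 1)) (Fin (n + 1)) ℂ) {p : S n}
    (hp : p.IsHomogeneous d) : (substHom M p).IsHomogeneous d := by
  have := hp.aeval (fun i => ∑ j, M i j • (X j : S n)) (n := 1) (fun i => isHomogeneous_lin (M i))
  simpa [substHom] using this

lemma pderiv_substHom {n : ℕ} (M : Matrix (Fin (n + 1)) (Fin (n + 1)) ℂ) (l : Fin (n + 1))
    (p : S n) : pderiv l (substHom M p) = ∑ j, M j l • substHom M (pderiv j p) := by
  induction p using MvPolynomial.induction_on with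
  | C a => simp [substHom]
  | add p q hp hq => simp [hp, hq, Finset.sum_add_distrib]
  | mul_X p i hp =>
    simp only [map_mul, Derivation.leibniz, hp, map_add, smul_eq_mul, smul_add,
      Finset.sum_add_distrib, pderiv_X, substHom_X, map_sum]
    have h1 : ∀ j, pderiv l (M i j • (X j : S n)) = if j = l then C (M i j) else 0 := by
      intro j
      rw [Derivation.map_smul, pderiv_X]
      by_cases h : l = j
      · subst h; simp [smul_eq_C_mul]
      · simp [Ne.symm h]
    have h2 : ∀ j, M j l • (substHom M p * substHom M (Pi.single (M := fun _ => S n) j 1 i)) =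
        if j = i then substHom M p * C (M i l) else 0 := by
      intro j
      by_cases h : j = i
      · subst h; simp [smul_eq_C_mul, mul_comm]
      · rw [Pi.single_eq_of_ne (Ne.symm h), if_neg h, map_zero, mul_zero, smul_zero]
    simp only [h1, h2, Finset.sum_ite_eq', Finset.mem_univ, if_true]
    congr 1
    rw [Finset.mul_sum]
    exact Finset.sum_congr rfl fun j _ => by rw [mul_smul_comm]

/-- A linear change of coordinates compatible with the Jacobian ideals identifies rigid forms. -/
theorem exists_eq_smul_substHom {n d : ℕ} (hd : 1 ≤ d) {f g : S n} (hf : f.IsHomogeneous d)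
    (hg : g.IsHomogeneous d) (hR : Rigid d f) (M N : Matrix (Fin (n + 1)) (Fin (n + 1)) ℂ)
    (hMN : N * M = 1) (h : ∀ q, substHom M (jac q g) ∈ jacobianIdeal f) :
    ∃ t : ℂ, substHom M g = t • f := by
  refine hR _ (isHomogeneous_substHom M hg) fun p => ?_
  have hX : ∀ k, (X k : S n) = ∑ i, N k i • substHom M (X i) := by
    intro k
    have h1 := substHom_comp M N (X k)
    rw [hMN, substHom_one, substHom_X, map_sum] at h1
    rw [← h1]
    exact Finset.sum_congr rfl fun i _ => map_smul _ _ _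
  rw [jac_apply, pderiv_substHom, hX, Finset.sum_mul]
  refine Submodule.sum_mem _ fun i _ => ?_
  rw [Finset.mul_sum]
  refine Submodule.sum_mem _ fun j _ => ?_
  rw [mul_smul_comm, smul_mul_assoc, ← map_mul]
  refine Submodule.smul_mem _ _ (Submodule.smul_mem _ _ ?_)
  have h2 := homogeneousComponent_mem_jacPiece hd hf (h (j, i))
  rwa [homogeneousComponent_eq_self (isHomogeneous_substHom M (isHomogeneous_jac hd hg _))] at h2

/-- The projection onto the degree `d` piece of the Jacobian ring. -/
def toRpiece {n : ℕ} (g : S n) (d : ℕ) : S n →ₗ[ℂ] Rpiece g d :=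
  (quotMap g ∘ₗ homogeneousComponent d).codRestrict _ fun h =>
    ⟨_, homogeneousComponent_isHomogeneous d h, rfl⟩

lemma coe_toRpiece {n d : ℕ} {g h : S n} (hh : h.IsHomogeneous d) :
    (toRpiece g d h : S n ⧸ jacobianIdeal g) = quotMap g h := by
  change quotMap g (homogeneousComponent d h) = _
  rw [homogeneousComponent_eq_self hh]

theorem recover_of_rigid {n d k : ℕ} (hd : 1 ≤ d) (hn : 1 ≤ n) (hk : 1 ≤ k) {f g : S n}
    (hf : f.IsHomogeneous d) (hP : PowersSpan d k f) (hR : Rigid d f) (hg : g.IsHomogeneous d)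
    (hsm : SmoothHyp g) (i : Rpiece f d ≃ₗ[ℂ] Rpiece g d)
    (hi : ∀ z : Rpiece f d,
      (∃ x : S n, x.IsHomogeneous 1 ∧
        (z : S n ⧸ jacobianIdeal f) = Ideal.Quotient.mk (jacobianIdeal f) (x ^ d)) ↔
      (∃ y : S n, y.IsHomogeneous 1 ∧
        (i z : S n ⧸ jacobianIdeal g) = Ideal.Quotient.mk (jacobianIdeal g) (y ^ d))) :
    ∃ (A : Matrix.GeneralLinearGroup (Fin (n + 1)) ℂ) (t : ℂ), t ≠ 0 ∧
      g = t • substLin (A : Matrix (Fin (n + 1)) (Fin (n + 1)) ℂ) f := by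
  let T : S n →ₗ[ℂ] S n ⧸ jacobianIdeal f :=
    (Rpiece f d).subtype ∘ₗ i.symm.toLinearMap ∘ₗ toRpiece g d
  have hT : ∀ h, T h = (i.symm (toRpiece g d h) : S n ⧸ jacobianIdeal f) := fun h => rfl
  have hex : ∀ y, ∃ c, quotMap f (lin c ^ d) = T (lin y ^ d) := by
    intro y
    obtain ⟨x, hx, hx'⟩ := (hi (i.symm (toRpiece g d (lin y ^ d)))).2
      ⟨lin y, isHomogeneous_lin y, by
        rw [LinearEquiv.apply_symm_apply, coe_toRpiece (isHomogeneous_lin_pow y d)]; rfl⟩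
    obtain ⟨c, rfl⟩ := exists_eq_lin hx
    exact ⟨c, hx'.symm⟩
  have hsurj : ∀ c, ∃ y, quotMap f (lin c ^ d) = T (lin y ^ d) := by
    intro c
    obtain ⟨x, hx, hx'⟩ := (hi (toRpiece f d (lin c ^ d))).1
      ⟨lin c, isHomogeneous_lin c, by rw [coe_toRpiece (isHomogeneous_lin_pow c d)]; rfl⟩
    obtain ⟨y, rfl⟩ := exists_eq_lin hx
    refine ⟨y, ?_⟩
    have h1 : i (toRpiece f d (lin c ^ d)) = toRpiece g d (lin y ^ d) := by
      apply Subtype.ext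
      rw [hx', coe_toRpiece (isHomogeneous_lin_pow y d)]
      rfl
    rw [hT, ← h1, LinearEquiv.symm_apply_apply, coe_toRpiece (isHomogeneous_lin_pow c d)]
  obtain ⟨M, hM, hTM⟩ := exists_matrix hd hn hk hf hP T hex hsurj
  have hMu : IsUnit M := Matrix.mulVec_surjective_iff_isUnit.1 hM
  have hTh : ∀ h : S n, h.IsHomogeneous d → T h = quotMap f (substHom M.transpose h) := by
    intro h hh
    rw [← sub_eq_zero, ← Module.forall_dual_apply_eq_zero_iff ℂ]
    intro a
    rw [map_sub, sub_eq_zero]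
    refine eq_of_forall_lin_pow (a := a ∘ₗ T)
      (b := a ∘ₗ quotMap f ∘ₗ (substHom M.transpose).toLinearMap) (fun c => ?_) hh
    have h1 : (substHom M.transpose).toLinearMap (lin c ^ d) = lin (M.mulVec c) ^ d := by
      rw [AlgHom.toLinearMap_apply, map_pow, substHom_apply, substLin_lin]
    change a (T (lin c ^ d)) = a (quotMap f ((substHom M.transpose).toLinearMap (lin c ^ d)))
    rw [h1, hTM]
  have hMt : IsUnit M.transpose := Matrix.isUnit_transpose M |>.2 hMu
  obtain ⟨A, hA⟩ := hMt
  have hinv : (↑A⁻¹ : Matrix (Fin (n + 1)) (Fin (n + 1)) ℂ) * M.transpose = 1 := by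
    rw [← hA]; exact A.inv_mul
  have hinv' : M.transpose * (↑A⁻¹ : Matrix (Fin (n + 1)) (Fin (n + 1)) ℂ) = 1 := by
    rw [← hA]; exact A.mul_inv
  obtain ⟨t, ht⟩ := exists_eq_smul_substHom hd hf hg hR M.transpose _ hinv (fun q => by
    have hq := isHomogeneous_jac hd hg q
    rw [← quotMap_eq_zero, ← hTh _ hq, hT]
    have : toRpiece g d (jac q g) = 0 := by
      apply Subtype.ext
      rw [coe_toRpiece hq, quotMap_eq_zero.2 (jac_mem_jacobianIdeal g q)]
      rfl
    rw [this, map_zero]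
    rfl)
  have hgt : g = t • substLin (↑A⁻¹ : Matrix (Fin (n + 1)) (Fin (n + 1)) ℂ) f := by
    rw [← substHom_apply, ← map_smul, ← ht, substHom_comp, hinv', substHom_one]
  refine ⟨A⁻¹, t, ?_, hgt⟩
  rintro rfl
  rw [zero_smul] at hgt
  have := hsm (fun _ => 1) (fun i => by rw [hgt]; simp)
  exact one_ne_zero (congrFun this 0)

lemma coeff_jac_add {n : ℕ} (i j : Fin (n + 1)) (p : S n) (m : Fin (n + 1) →₀ ℕ) :
    coeff (m + Finsupp.single j 1) (jac (i, j) p) =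
      coeff (m + Finsupp.single i 1) p * (m i + 1) := by
  rw [jac_apply, mul_comm, coeff_mul_X, coeff_pderiv]

lemma coeff_jac_of_eq_zero {n : ℕ} (i j : Fin (n + 1)) (p : S n) {m : Fin (n + 1) →₀ ℕ}
    (hm : m j = 0) : coeff m (jac (i, j) p) = 0 := by
  classical
  rw [jac_apply, coeff_X_mul', if_neg (by simpa using hm)]

lemma coeff_jac_self {n : ℕ} (i : Fin (n + 1)) (p : S n) (m : Fin (n + 1) →₀ ℕ) :
    coeff m (jac (i, i) p) = m i * coeff m p := by
  by_cases hm : m i = 0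
  · rw [coeff_jac_of_eq_zero i i p hm, hm]; simp
  · have h : m = (m - Finsupp.single i 1) + Finsupp.single i 1 := by
      ext x
      by_cases hx : i = x
      · subst hx; simp; omega
      · simp [hx]
    have h1 := coeff_jac_add i i p (m - Finsupp.single i 1)
    rw [← h] at h1
    rw [h1, mul_comm]
    congr 1
    have h2 := DFunLike.congr_fun h i
    rw [Finsupp.add_apply, Finsupp.single_eq_same] at h2
    exact_mod_cast h2.symm

/-- The sum of all monomials of degree `d` involving exactly four variables. -/
def fourForm (n d : ℕ) : S n :=
  ∑ m ∈ (expo n d).filter (fun m => m.support.card = 4), monomial m 1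

lemma isHomogeneous_fourForm (n d : ℕ) : (fourForm n d).IsHomogeneous d :=
  (homogeneousSubmodule _ ℂ d).sum_mem fun _ hm =>
    isHomogeneous_monomial _ (mem_expo.1 (Finset.mem_filter.1 hm).1)

lemma coeff_fourForm {n d : ℕ} (m : Fin (n + 1) →₀ ℕ) :
    coeff m (fourForm n d) = if m.degree = d ∧ m.support.card = 4 then 1 else 0 := by
  classical
  simp only [fourForm, coeff_sum, coeff_monomial, Finset.sum_ite_eq', Finset.mem_filter, mem_expo]

lemma coeff_jac_fourForm_of_support {n d : ℕ} (q : Fin (n + 1) × Fin (n + 1))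
    {m : Fin (n + 1) →₀ ℕ} (hm : m.support.card ≤ 2) : coeff m (jac q (fourForm n d)) = 0 := by
  classical
  obtain ⟨i, j⟩ := q
  by_cases h0 : m j = 0
  · exact coeff_jac_of_eq_zero _ _ _ h0
  · obtain ⟨m', rfl⟩ : ∃ m', m = m' + Finsupp.single j 1 := by
      refine ⟨m - Finsupp.single j 1, ?_⟩
      ext x
      by_cases hx : j = x
      · subst hx; simp; omega
      · simp [hx]
    rw [coeff_jac_add, coeff_fourForm, if_neg, zero_mul]
    rintro ⟨-, h⟩
    have h1 : (m' + Finsupp.single i 1).support ⊆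
        insert i (m' + Finsupp.single j 1).support := by
      intro x hx
      simp only [Finset.mem_insert, Finsupp.mem_support_iff, Finsupp.add_apply,
        Finsupp.single_apply] at hx ⊢
      by_cases hxi : x = i
      · exact Or.inl hxi
      · rw [if_neg (Ne.symm hxi)] at hx
        right; omega
    have h2 := (Finset.card_le_card h1).trans (Finset.card_insert_le _ _)
    omega

/-- The exponent `(d - 2) e_k + e_a + e_b`. -/
abbrev triple {n : ℕ} (d : ℕ) (k a b : Fin (n + 1)) : Fin (n + 1) →₀ ℕ :=
  Finsupp.single k (d - 2) + Finsupp.single a 1 + Finsupp.single b 1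

/-- The exponent `(d - 3) e_k + e_a + e_b + e_i`. -/
abbrev quad {n : ℕ} (d : ℕ) (k a b i : Fin (n + 1)) : Fin (n + 1) →₀ ℕ :=
  Finsupp.single k (d - 3) + Finsupp.single a 1 + Finsupp.single b 1 + Finsupp.single i 1

lemma coeff_quad_fourForm {n d : ℕ} (hd : 4 ≤ d) {k a b i : Fin (n + 1)} (hka : k ≠ a)
    (hkb : k ≠ b) (hab : a ≠ b) (hki : k ≠ i) (hai : a ≠ i) (hbi : b ≠ i) :
    coeff (quad d k a b i) (fourForm n d) = 1 := by
  classical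
  rw [coeff_fourForm, if_pos]
  refine ⟨by simp only [map_add, Finsupp.degree_single]; omega, ?_⟩
  have : (quad d k a b i).support = {k, a, b, i} := by
    ext x
    simp only [Finsupp.mem_support_iff, Finsupp.add_apply, Finsupp.single_apply,
      Finset.mem_insert, Finset.mem_singleton, eq_comm (a := x)]
    split_ifs <;> simp_all <;> omega
  rw [this, Finset.card_insert_of_notMem, Finset.card_insert_of_notMem,
    Finset.card_insert_of_notMem, Finset.card_singleton] <;> simp [*]

lemma coeff_fourForm_eq_zero {n d : ℕ} {m : Fin (n + 1) →₀ ℕ} {a b c : Fin (n + 1)}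
    (h : ∀ x, m x ≠ 0 → x = a ∨ x = b ∨ x = c) : coeff m (fourForm n d) = 0 := by
  classical
  rw [coeff_fourForm, if_neg]
  rintro ⟨-, h4⟩
  have : m.support ⊆ {a, b, c} := fun x hx => by
    simpa using h x (Finsupp.mem_support_iff.1 hx)
  have := (Finset.card_le_card this).trans Finset.card_le_three
  omega

lemma triple_eq {n d : ℕ} (hd : 4 ≤ d) (k a b : Fin (n + 1)) : triple d k a b =
    Finsupp.single k (d - 3) + Finsupp.single a 1 + Finsupp.single b 1 + Finsupp.single k 1 := by
  have h : d - 2 = (d - 3) + 1 := by omega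
  rw [triple, h, Finsupp.single_add]
  abel

lemma coeff_triple_jac_fourForm {n d : ℕ} (hd : 4 ≤ d) {k a b : Fin (n + 1)} (hka : k ≠ a)
    (hkb : k ≠ b) (hab : a ≠ b) (i j : Fin (n + 1)) :
    coeff (triple d k a b) (jac (i, j) (fourForm n d)) =
      if j = k then (if i = k ∨ i = a ∨ i = b then 0 else 1) else 0 := by
  by_cases hjk : j = k
  · subst hjk
    rw [if_pos rfl, triple_eq hd, coeff_jac_add]
    split_ifs with hi
    · rw [coeff_fourForm_eq_zero (a := j) (b := a) (c := b), zero_mul]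
      intro x hx
      by_contra! hcon
      obtain ⟨h1, h2, h3⟩ := hcon
      rcases hi with rfl | rfl | rfl <;> simp [*] at hx
    · push Not at hi
      obtain ⟨h1, h2, h3⟩ := hi
      rw [coeff_quad_fourForm hd hka hkb hab h1.symm h2.symm h3.symm]
      simp [h1.symm, h2.symm, h3.symm]
  · rw [if_neg hjk]
    by_cases hja : j = a
    · subst hja
      have : triple d k j b = Finsupp.single k (d - 2) + Finsupp.single b 1 + Finsupp.single j 1 := by
        rw [triple]; abel
      rw [this, coeff_jac_add, coeff_fourForm_eq_zero (a := k) (b := b) (c := i), zero_mul]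
      intro x hx
      by_contra! hcon
      obtain ⟨h1, h2, h3⟩ := hcon
      simp [h1.symm, h2.symm, h3.symm] at hx
    by_cases hjb : j = b
    · subst hjb
      rw [coeff_jac_add, coeff_fourForm_eq_zero (a := k) (b := a) (c := i), zero_mul]
      intro x hx
      by_contra! hcon
      obtain ⟨h1, h2, h3⟩ := hcon
      simp [h1.symm, h2.symm, h3.symm] at hx
    · exact coeff_jac_of_eq_zero _ _ _
        (by simp [Ne.symm hjk, Ne.symm hja, Ne.symm hjb])

lemma sum_ite_triple {n : ℕ} {k a b : Fin (n + 1)} (hka : k ≠ a) (hkb : k ≠ b) (hab : a ≠ b)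
    (h : Fin (n + 1) → ℂ) :
    ∑ i, h i * (if i = k ∨ i = a ∨ i = b then 0 else 1) = ∑ i, h i - h k - h a - h b := by
  have : ∀ i, h i * (if i = k ∨ i = a ∨ i = b then 0 else 1) = h i -
      (if i = k then h k else 0) - (if i = a then h a else 0) - (if i = b then h b else 0) := by
    intro i
    by_cases h1 : i = k
    · subst h1; simp [hka, hkb]
    by_cases h2 : i = a
    · subst h2; simp [h1, hab]
    by_cases h3 : i = b
    · subst h3; simp [h1, h2]
    simp [h1, h2, h3]
  simp only [this, Finset.sum_sub_distrib, Finset.sum_ite_eq', Finset.mem_univ, if_true]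

lemma coeff_triple_sum {n d : ℕ} (hd : 4 ≤ d) {k a b : Fin (n + 1)} (hka : k ≠ a)
    (hkb : k ≠ b) (hab : a ≠ b) (c : Fin (n + 1) × Fin (n + 1) → ℂ) :
    coeff (triple d k a b) (∑ q, c q • jac q (fourForm n d)) =
      ∑ i, c (i, k) - c (k, k) - c (a, k) - c (b, k) := by
  rw [← sum_ite_triple hka hkb hab (fun i => c (i, k)), coeff_sum, Fintype.sum_prod_type]
  refine Finset.sum_congr rfl fun i _ => ?_
  simp only [coeff_smul, coeff_triple_jac_fourForm hd hka hkb hab, smul_eq_mul, mul_ite, mul_zero,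
    Finset.sum_ite_eq', Finset.mem_univ, if_true]

lemma exists_notMem {n : ℕ} (s : Finset (Fin (n + 1))) (hs : s.card ≤ n) : ∃ x, x ∉ s := by
  by_contra! h
  have : s = Finset.univ := Finset.eq_univ_iff_forall.2 h
  rw [this, Finset.card_univ, Fintype.card_fin] at hs
  omega

lemma exists_five {n : ℕ} (hn : 4 ≤ n) (a b : Fin (n + 1)) : ∃ e i k : Fin (n + 1),
    e ≠ a ∧ e ≠ b ∧ i ≠ a ∧ i ≠ b ∧ i ≠ e ∧ k ≠ a ∧ k ≠ b ∧ k ≠ e ∧ k ≠ i := by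
  classical
  obtain ⟨e, he⟩ := exists_notMem {a, b} (Finset.card_le_two.trans (by omega))
  obtain ⟨i, hi⟩ := exists_notMem {a, b, e} (Finset.card_le_three.trans (by omega))
  obtain ⟨k, hk⟩ := exists_notMem {a, b, e, i} (Finset.card_le_four.trans (by omega))
  simp only [Finset.mem_insert, Finset.mem_singleton, not_or] at he hi hk
  exact ⟨e, i, k, he.1, he.2, hi.1, hi.2.1, hi.2.2, hk.1, hk.2.1, hk.2.2.1, hk.2.2.2⟩

lemma eq_zero_of_triple {n : ℕ} (hn : 4 ≤ n) (k : Fin (n + 1)) (h : Fin (n + 1) → ℂ)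
    (hh : ∀ a b, k ≠ a → k ≠ b → a ≠ b → ∑ i, h i - h k - h a - h b = 0) :
    ∀ i, i ≠ k → h i = 0 := by
  have heq : ∀ a b, a ≠ k → b ≠ k → a ≠ b → h a = h b := by
    intro a b ha hb hab
    obtain ⟨x, hx⟩ := exists_notMem {k, a, b} (Finset.card_le_three.trans (by omega))
    simp only [Finset.mem_insert, Finset.mem_singleton, not_or] at hx
    have h1 := hh x a (Ne.symm hx.1) ha.symm hx.2.1
    have h2 := hh x b (Ne.symm hx.1) hb.symm hx.2.2
    linear_combination h2 - h1
  intro i hi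
  have h1 : ∀ j, h j = h i + (if j = k then h k - h i else 0) := by
    intro j
    split_ifs with hj
    · rw [hj]; ring
    · by_cases hji : j = i
      · rw [hji, add_zero]
      · rw [heq j i hj hi hji, add_zero]
  have h2 : ∑ j, h j = (n + 1) * h i + (h k - h i) := by
    rw [Finset.sum_congr rfl fun j _ => h1 j, Finset.sum_add_distrib]
    simp
  obtain ⟨x, hx⟩ := exists_notMem {k, i} (Finset.card_le_two.trans (by omega))
  simp only [Finset.mem_insert, Finset.mem_singleton, not_or] at hx
  have h3 := hh x i (Ne.symm hx.1) hi.symm hx.2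
  rw [h2, heq x i hx.1 hi hx.2] at h3
  have h4 : ((n : ℂ) - 2) * h i = 0 := by linear_combination h3
  refine (mul_eq_zero.1 h4).resolve_left fun h5 => ?_
  have : (n : ℂ) = (2 : ℕ) := by rw [sub_eq_zero] at h5; exact_mod_cast h5
  have := Nat.cast_injective this
  omega

lemma coeff_jac_diag_sum {n : ℕ} (b : Fin (n + 1) × Fin (n + 1) → ℂ)
    (hb : ∀ i k, i ≠ k → b (i, k) = 0) (p : S n) (m : Fin (n + 1) →₀ ℕ) :
    coeff m (∑ q, b q • jac q p) = (∑ l, b (l, l) * m l) * coeff m p := by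
  rw [coeff_sum, Fintype.sum_prod_type, Finset.sum_mul]
  refine Finset.sum_congr rfl fun i _ => ?_
  rw [Finset.sum_eq_single i]
  · rw [coeff_smul, coeff_jac_self, smul_eq_mul, mul_assoc]
  · intro k _ hk
    rw [hb i k hk.symm, zero_smul, coeff_zero]
  · simp

lemma sum_mul_quad {n d : ℕ} (hd : 4 ≤ d) (β : Fin (n + 1) → ℂ) (k a b i : Fin (n + 1)) :
    ∑ l, β l * (quad d k a b i l : ℂ) = (d - 3) * β k + β a + β b + β i := by
  have h3 : ((d - 3 : ℕ) : ℂ) = d - 3 := by rw [Nat.cast_sub (by omega)]; norm_num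
  simp only [Finsupp.add_apply, Nat.cast_add, mul_add, Finset.sum_add_distrib, Finsupp.single_apply,
    Nat.cast_ite, Nat.cast_zero, mul_ite, mul_zero, Finset.sum_ite_eq, Finset.mem_univ, if_true, h3,
    Nat.cast_one, mul_one]
  ring

lemma natCast_ne_zero_of_four_le {d : ℕ} (hd : 4 ≤ d) : (d : ℂ) ≠ 0 := by
  exact_mod_cast (by omega : d ≠ 0)

theorem jac_fourForm_independent {n d : ℕ} (hn : 4 ≤ n) (hd : 4 ≤ d)
    (b : Fin (n + 1) × Fin (n + 1) → ℂ) (h : ∑ q, b q • jac q (fourForm n d) = 0) : b = 0 := by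
  have hoff : ∀ i k, i ≠ k → b (i, k) = 0 := by
    intro i k hik
    refine eq_zero_of_triple hn k (fun i => b (i, k)) (fun x y hx hy hxy => ?_) i hik
    rw [← coeff_triple_sum hd hx hy hxy, h, coeff_zero]
  have hq : ∀ k x y i : Fin (n + 1), k ≠ x → k ≠ y → x ≠ y → k ≠ i → x ≠ i → y ≠ i →
      (d - 3) * b (k, k) + b (x, x) + b (y, y) + b (i, i) = 0 := by
    intro k x y i h1 h2 h3 h4 h5 h6
    have := coeff_jac_diag_sum b hoff (fourForm n d) (quad d k x y i)
    rw [h, coeff_zero, coeff_quad_fourForm hd h1 h2 h3 h4 h5 h6, mul_one,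
      sum_mul_quad hd (fun l => b (l, l))] at this
    exact this.symm
  have heq : ∀ x y : Fin (n + 1), b (x, x) = b (y, y) := by
    intro x y
    by_cases hxy : x = y
    · rw [hxy]
    obtain ⟨e, i, k, h1, h2, h3, h4, h5, h6, h7, h8, h9⟩ := exists_five hn x y
    have e1 := hq k x e i h6 h8 h1.symm h9 h3.symm h5.symm
    have e2 := hq k y e i h7 h8 h2.symm h9 h4.symm h5.symm
    linear_combination e1 - e2
  funext ⟨i, j⟩
  by_cases hij : i = j
  · subst hij
    obtain ⟨e, x, k, h1, h2, h3, h4, h5, h6, h7, h8, h9⟩ := exists_five hn i i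
    have e1 := hq k i e x h6 h8 h1.symm h9 h3.symm h5.symm
    rw [heq k i, heq e i, heq x i] at e1
    have e2 : (d : ℂ) * b (i, i) = 0 := by linear_combination e1
    exact (mul_eq_zero.1 e2).resolve_left (natCast_ne_zero_of_four_le hd)
  · exact hoff i j hij

lemma coeff_eq_zero_of_mem_jacPiece_fourForm {n d : ℕ} {h : S n}
    (hh : h ∈ jacPiece (fourForm n d)) {m : Fin (n + 1) →₀ ℕ} (hm : m.support.card ≤ 2) :
    coeff m h = 0 := by
  obtain ⟨c, rfl⟩ := (Submodule.mem_span_range_iff_exists_fun ℂ).1 hh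
  rw [coeff_sum]
  exact Finset.sum_eq_zero fun q _ => by
    rw [coeff_smul, coeff_jac_fourForm_of_support q hm, smul_zero]

lemma card_support_pair {n : ℕ} (k b : Fin (n + 1)) (r s : ℕ) :
    (Finsupp.single k r + Finsupp.single b s).support.card ≤ 2 := by
  classical
  have : (Finsupp.single k r + Finsupp.single b s).support ⊆ {k, b} := by
    intro x hx
    by_contra hcon
    simp only [Finset.mem_insert, Finset.mem_singleton, not_or] at hcon
    simp [Ne.symm hcon.1, Ne.symm hcon.2] at hx
  exact (Finset.card_le_card this).trans Finset.card_le_two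

theorem rigid_fourForm {n d : ℕ} (hn : 4 ≤ n) (hd : 4 ≤ d) : Rigid d (fourForm n d) := by
  intro g hg hmem
  have hd0 := natCast_ne_zero_of_four_le hd
  have hgm : g ∈ jacPiece (fourForm n d) := by
    have h1 := hg.sum_X_mul_pderiv
    have h2 : g = (d : ℂ)⁻¹ • ∑ i, jac (i, i) g := by
      simp only [jac_apply]
      rw [h1, ← Nat.cast_smul_eq_nsmul ℂ, inv_smul_smul₀ hd0]
    rw [h2]
    exact Submodule.smul_mem _ _ (Submodule.sum_mem _ fun i _ => hmem (i, i))
  obtain ⟨b, hb⟩ := (Submodule.mem_span_range_iff_exists_fun ℂ).1 hgm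
  have hoff : ∀ i k, i ≠ k → b (i, k) = 0 := by
    intro i k hik
    refine eq_zero_of_triple hn k (fun i => b (i, k)) (fun x y hx hy hxy => ?_) i hik
    rw [← coeff_triple_sum hd hx hy hxy, hb]
    have h1 := coeff_eq_zero_of_mem_jacPiece_fourForm (hmem (x, k))
      (card_support_pair k y (d - 2 + 1) 1)
    have h2 : Finsupp.single k (d - 2 + 1) + Finsupp.single y 1 =
        Finsupp.single k (d - 2) + Finsupp.single y 1 + Finsupp.single k 1 := by
      rw [Finsupp.single_add]; abel
    have h3 : Finsupp.single k (d - 2) + Finsupp.single y 1 + Finsupp.single x 1 =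
        triple d k x y := by rw [triple]; abel
    rw [h2, coeff_jac_add, h3] at h1
    exact (mul_eq_zero.1 h1).resolve_right (Nat.cast_add_one_ne_zero _)
  set β : Fin (n + 1) → ℂ := fun l => b (l, l) with hβ
  have hcoeff : ∀ m, coeff m g = (∑ l, β l * m l) * coeff m (fourForm n d) := by
    intro m
    rw [← coeff_jac_diag_sum b hoff, hb]
  have heq : ∀ x y, β x = β y := by
    intro x y
    by_cases hxy : x = y
    · rw [hxy]
    obtain ⟨e, i, k, h1, h2, h3, h4, h5, h6, h7, h8, h9⟩ := exists_five hn x y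
    obtain ⟨c, hc⟩ := (Submodule.mem_span_range_iff_exists_fun ℂ).1 (hmem (i, k))
    have key : ∀ a b, k ≠ a → k ≠ b → a ≠ b → ∑ l, c (l, k) - c (k, k) - c (a, k) - c (b, k) =
        coeff (quad d k a b i) g * ((Finsupp.single k (d - 3) + Finsupp.single a 1 +
          Finsupp.single b 1 : Fin (n + 1) →₀ ℕ) i + 1) := by
      intro a b ha hb hab
      rw [← coeff_triple_sum hd ha hb hab, hc, triple_eq hd, coeff_jac_add]
    have key1 : ∀ a b, k ≠ a → k ≠ b → a ≠ b → i ≠ a → i ≠ b →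
        ∑ l, c (l, k) - c (k, k) - c (a, k) - c (b, k) = (d - 3) * β k + β a + β b + β i := by
      intro a b ha hb hab hia hib
      rw [key a b ha hb hab, hcoeff, coeff_quad_fourForm hd ha hb hab h9 hia.symm hib.symm,
        sum_mul_quad hd]
      simp [Ne.symm hia, Ne.symm hib, h9]
    have key2 : ∀ a, k ≠ a → i ≠ a → ∑ l, c (l, k) - c (k, k) - c (a, k) - c (i, k) = 0 := by
      intro a ha hia
      rw [key a i ha h9 hia.symm, hcoeff, coeff_fourForm_eq_zero (a := k) (b := a) (c := i),
        mul_zero, zero_mul]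
      intro z hz
      by_contra! hcon
      obtain ⟨h1, h2, h3⟩ := hcon
      simp [h1.symm, h2.symm, h3.symm] at hz
    have e1 := key1 x e h6 h8 h1.symm h3 h5
    have e2 := key1 y e h7 h8 h2.symm h4 h5
    have e3 := key2 x h6 h3
    have e4 := key2 y h7 h4
    linear_combination e2 - e1 + e3 - e4
  refine ⟨β 0 * d, MvPolynomial.ext _ _ fun m => ?_⟩
  rw [hcoeff, coeff_smul, smul_eq_mul, coeff_fourForm]
  split_ifs with hm
  · congr 1
    rw [← hm.1, Finsupp.degree_eq_sum, Nat.cast_sum, Finset.mul_sum]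
    exact Finset.sum_congr rfl fun l _ => by rw [heq l 0]
  · simp

section PolyFun

variable {M : Type} [AddCommGroup M] [Module ℂ M]

lemma isPolyFun_linear (l : M →ₗ[ℂ] ℂ) : IsPolyFun (fun x => l x) :=
  Algebra.subset_adjoin ⟨l, rfl⟩

lemma isPolyFun_const (c : ℂ) : IsPolyFun (fun _ : M => c) :=
  Subalgebra.algebraMap_mem (Algebra.adjoin ℂ {ψ : M → ℂ | ∃ l : M →ₗ[ℂ] ℂ, ψ = ⇑l}) c

lemma IsPolyFun.add {φ ψ : M → ℂ} (hφ : IsPolyFun φ) (hψ : IsPolyFun ψ) :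
    IsPolyFun (fun x => φ x + ψ x) := Subalgebra.add_mem _ hφ hψ

lemma IsPolyFun.sub {φ ψ : M → ℂ} (hφ : IsPolyFun φ) (hψ : IsPolyFun ψ) :
    IsPolyFun (fun x => φ x - ψ x) := Subalgebra.sub_mem _ hφ hψ

lemma IsPolyFun.mul {φ ψ : M → ℂ} (hφ : IsPolyFun φ) (hψ : IsPolyFun ψ) :
    IsPolyFun (fun x => φ x * ψ x) := Subalgebra.mul_mem _ hφ hψ

lemma isPolyFun_sum {ι : Type*} (s : Finset ι) {φ : ι → M → ℂ} (h : ∀ i, IsPolyFun (φ i)) :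
    IsPolyFun (fun x => ∑ i ∈ s, φ i x) := by
  have := Subalgebra.sum_mem (Algebra.adjoin ℂ {ψ : M → ℂ | ∃ l : M →ₗ[ℂ] ℂ, ψ = ⇑l})
    (t := s) (f := φ) fun i _ => h i
  rwa [show ∑ i ∈ s, φ i = fun x => ∑ i ∈ s, φ i x from funext fun x => by simp] at this

lemma isPolyFun_prod {ι : Type*} (s : Finset ι) {φ : ι → M → ℂ} (h : ∀ i, IsPolyFun (φ i)) :
    IsPolyFun (fun x => ∏ i ∈ s, φ i x) := by
  have := Subalgebra.prod_mem (Algebra.adjoin ℂ {ψ : M → ℂ | ∃ l : M →ₗ[ℂ] ℂ, ψ = ⇑l})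
    (t := s) (f := φ) fun i _ => h i
  rwa [show ∏ i ∈ s, φ i = fun x => ∏ i ∈ s, φ i x from funext fun x => by simp] at this

lemma isPolyFun_det {ι : Type*} [Fintype ι] [DecidableEq ι] {A : M → Matrix ι ι ℂ}
    (h : ∀ i j, IsPolyFun (fun x => A x i j)) : IsPolyFun (fun x => (A x).det) := by
  simp only [Matrix.det_apply']
  exact isPolyFun_sum _ fun σ => (isPolyFun_const _).mul (isPolyFun_prod _ fun i => h _ _)

lemma isPolyFun_adjugate {ι : Type*} [Fintype ι] [DecidableEq ι] {A : M → Matrix ι ι ℂ}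
    (h : ∀ i j, IsPolyFun (fun x => A x i j)) (i j : ι) :
    IsPolyFun (fun x => (A x).adjugate i j) := by
  simp only [Matrix.adjugate_apply]
  refine isPolyFun_det fun k l => ?_
  by_cases hk : k = j
  · subst hk
    simp only [Matrix.updateRow_self]
    exact isPolyFun_const _
  · simp only [Matrix.updateRow_ne hk]
    exact h k l

/-- Injectivity of a family of linear maps depending polynomially on a parameter is an open
condition. -/
theorem exists_isPolyFun_injective {U V : Type*} [AddCommGroup U] [Module ℂ U]
    [FiniteDimensional ℂ U] [AddCommGroup V] [Module ℂ V] (T : M → U →ₗ[ℂ] V)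
    (hT : ∀ u (ν : V →ₗ[ℂ] ℂ), IsPolyFun (fun x => ν (T x u))) (x₀ : M)
    (h₀ : Function.Injective (T x₀)) :
    ∃ φ : M → ℂ, IsPolyFun φ ∧ φ x₀ ≠ 0 ∧ ∀ x, φ x ≠ 0 → Function.Injective (T x) := by
  obtain ⟨L, hL⟩ := LinearMap.exists_leftInverse_of_injective _ (LinearMap.ker_eq_bot.2 h₀)
  let b := Module.finBasis ℂ U
  refine ⟨fun x => (LinearMap.toMatrix b b (L ∘ₗ T x)).det, isPolyFun_det fun i j => ?_, ?_, ?_⟩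
  · simp only [LinearMap.toMatrix_apply]
    exact hT (b j) (b.coord i ∘ₗ L)
  · simp [hL]
  · intro x hx
    simp only [LinearMap.det_toMatrix] at hx
    have h1 : IsUnit (L ∘ₗ T x) := (LinearMap.isUnit_iff_isUnit_det _).2 (isUnit_iff_ne_zero.2 hx)
    have h2 := ((Module.End.isUnit_iff _).1 h1).1
    rw [LinearMap.coe_comp] at h2
    exact h2.of_comp

lemma isPolyFun_coeff_prod {n : ℕ} {ι : Type*} (s : Finset ι) {P : ι → M → S n}
    (h : ∀ i m, IsPolyFun (fun x => coeff m (P i x))) (m : Fin (n + 1) →₀ ℕ) :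
    IsPolyFun (fun x => coeff m (∏ i ∈ s, P i x)) := by
  classical
  induction s using Finset.induction_on generalizing m with
  | empty => simpa using isPolyFun_const _
  | insert a s ha ih =>
    simp only [Finset.prod_insert ha, coeff_mul]
    exact isPolyFun_sum _ fun i => (h _ _).mul (ih _)

end PolyFun

theorem exists_isPolyFun_rigid {n d : ℕ} (f₀ : homogeneousSubmodule (Fin (n + 1)) ℂ d)
    (hR : Rigid d (f₀ : S n))
    (hI : ∀ b : Fin (n + 1) × Fin (n + 1) → ℂ, ∑ q, b q • jac q (f₀ : S n) = 0 → b = 0) :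
    ∃ φ : homogeneousSubmodule (Fin (n + 1)) ℂ d → ℂ, IsPolyFun φ ∧ φ f₀ ≠ 0 ∧
      ∀ f, φ f ≠ 0 → Rigid d (f : S n) := by
  have hf₀ : (f₀ : S n) ≠ 0 := by
    intro h
    have := congrFun (hI (fun _ => 1) (by simp [h])) (0, 0)
    exact one_ne_zero this
  obtain ⟨l, hl⟩ : ∃ l : Module.Dual ℂ (S n), l (f₀ : S n) ≠ 0 := by
    by_contra! h
    exact hf₀ ((Module.forall_dual_apply_eq_zero_iff ℂ _).1 h)
  have : FiniteDimensional ℂ (homogeneousSubmodule (Fin (n + 1)) ℂ d) :=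
    Module.Finite.iff_fg.2 (homogeneousSubmodule_fg _ _ _)
  let W := homogeneousSubmodule (Fin (n + 1)) ℂ d
  let J := Fin (n + 1) × Fin (n + 1)
  let T : W → (W × (J → J → ℂ)) →ₗ[ℂ] ((J → S n) × ℂ) := fun f =>
    LinearMap.prod
      (LinearMap.pi fun p => jac p ∘ₗ W.subtype ∘ₗ LinearMap.fst ℂ W (J → J → ℂ) -
        Fintype.linearCombination ℂ (fun q => jac q (f : S n)) ∘ₗ LinearMap.proj p ∘ₗ
          LinearMap.snd ℂ W (J → J → ℂ))
      (l ∘ₗ W.subtype ∘ₗ LinearMap.fst ℂ W (J → J → ℂ))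
  have hT : ∀ f u, T f u = (fun p => jac p (u.1 : S n) - ∑ q, u.2 p q • jac q (f : S n),
      l (u.1 : S n)) := fun f u => rfl
  obtain ⟨φ, hφ, hφ₀, hφ'⟩ := exists_isPolyFun_injective T (fun u ν => by
    have h1 : ∀ f, ν (T f u) = ν (fun p => jac p (u.1 : S n), l (u.1 : S n)) -
        (ν ∘ₗ LinearMap.inl ℂ (J → S n) ℂ ∘ₗ
          LinearMap.pi fun p => ∑ q, u.2 p q • (jac q ∘ₗ W.subtype)) f := by
      intro f
      rw [LinearMap.comp_apply, ← map_sub, hT]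
      congr 1
      refine Prod.ext (funext fun p => ?_) ?_
      · simp
      · simp
    simp only [h1]
    exact (isPolyFun_const _).sub (isPolyFun_linear _)) f₀ (by
    rw [← LinearMap.ker_eq_bot, LinearMap.ker_eq_bot']
    rintro ⟨g, b⟩ h
    rw [hT, Prod.mk_eq_zero] at h
    obtain ⟨h1, h2⟩ := h
    have h3 : ∀ p, jac p (g : S n) = ∑ q, b p q • jac q (f₀ : S n) := fun p =>
      sub_eq_zero.1 (congrFun h1 p)
    obtain ⟨t, ht⟩ := hR g g.2 fun p => by
      rw [h3 p]
      exact Submodule.sum_mem _ fun q _ => Submodule.smul_mem _ _ (Submodule.subset_span ⟨q, rfl⟩)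
    have hg : (g : S n) = 0 := by
      have h2 : l (g : S n) = 0 := h2
      rw [ht, map_smul, smul_eq_mul] at h2
      rw [ht, (mul_eq_zero.1 h2).resolve_right hl, zero_smul]
    refine Prod.ext (Subtype.ext hg) (funext fun p => hI _ ?_)
    rw [← h3 p, hg, map_zero])
  refine ⟨fun f => φ f * l (f : S n), hφ.mul (isPolyFun_linear (l ∘ₗ W.subtype)),
    mul_ne_zero hφ₀ hl, fun f hf => ?_⟩
  obtain ⟨hf1, hf2⟩ := mul_ne_zero_iff.1 hf
  have hinj := hφ' f hf1
  intro g hg hmem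
  choose c hc using fun p => (Submodule.mem_span_range_iff_exists_fun ℂ).1 (hmem p)
  have h0 : T f (l (f : S n) • ⟨g, hg⟩ - l g • f,
      fun p q => l (f : S n) * c p q - l g * (if q = p then 1 else 0)) = T f 0 := by
    rw [map_zero, hT, Prod.mk_eq_zero]
    constructor
    · funext p
      simp only [Submodule.coe_sub, Submodule.coe_smul, map_sub, map_smul, sub_smul,
        Finset.sum_sub_distrib, mul_smul, ite_smul, one_smul, zero_smul, ← Finset.smul_sum,
        Finset.sum_ite_eq', Finset.mem_univ, if_true, Pi.zero_apply]
      rw [← hc p]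
      abel
    · simp [mul_comm]
  have h1 := congrArg Subtype.val (Prod.ext_iff.1 (hinj h0)).1
  simp only [Submodule.coe_sub, Submodule.coe_smul, Prod.fst_zero, Submodule.coe_zero] at h1
  refine ⟨(l (f : S n))⁻¹ * l g, ?_⟩
  rw [mul_smul, ← sub_eq_zero.1 h1, inv_smul_smul₀ hf2]

/-- The exponent `(d - 1) e_i + e_j`. -/
abbrev pairExp {n : ℕ} (d : ℕ) (i j : Fin (n + 1)) : Fin (n + 1) →₀ ℕ :=
  Finsupp.single i (d - 1) + Finsupp.single j 1

lemma degree_pairExp {n d : ℕ} (hd : 1 ≤ d) (i j : Fin (n + 1)) : (pairExp d i j).degree = d := by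
  rw [map_add, Finsupp.degree_single, Finsupp.degree_single, Nat.sub_add_cancel hd]

lemma pairExp_self {n d : ℕ} (hd : 1 ≤ d) (i : Fin (n + 1)) :
    pairExp d i i = d • Finsupp.single i 1 := by
  rw [pairExp, ← Finsupp.single_add, Nat.sub_add_cancel hd, Finsupp.smul_single, smul_eq_mul, mul_one]

lemma mem_closure_pairExp {n d : ℕ} (hd : 1 ≤ d) {e : Fin (n + 1) →₀ ℕ}
    (he : e.degree = (n + 1) * (n + 1) * d * d) :
    e ∈ AddSubmonoid.closure {m : Fin (n + 1) →₀ ℕ | ∃ i j, m = pairExp d i j} := by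
  classical
  set A := AddSubmonoid.closure {m : Fin (n + 1) →₀ ℕ | ∃ i j, m = pairExp d i j}
  have hA : ∀ i j, pairExp d i j ∈ A := fun i j => AddSubmonoid.subset_closure ⟨i, j, rfl⟩
  obtain ⟨i₀, hi₀⟩ : ∃ i, (n + 1) * d * d ≤ e i := by
    by_contra! h
    have h1 : ∑ i, e i < ∑ _i : Fin (n + 1), (n + 1) * d * d :=
      Finset.sum_lt_sum_of_nonempty Finset.univ_nonempty fun i _ => h i
    rw [← Finsupp.degree_eq_sum, he, Finset.sum_const, Finset.card_univ, Fintype.card_fin,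
      smul_eq_mul] at h1
    apply h1.ne
    ring
  set R := ∑ j ∈ Finset.univ.erase i₀, e j % d with hR
  set Q := ∑ j ∈ Finset.univ.erase i₀, e j / d with hQ
  have hRle : (d - 1) * R ≤ e i₀ := by
    have h1 : R ≤ (n + 1) * d := by
      calc R ≤ ∑ _j ∈ Finset.univ.erase i₀, d :=
            Finset.sum_le_sum fun j _ => (Nat.mod_lt _ (by omega)).le
        _ ≤ ∑ _j : Fin (n + 1), d := Finset.sum_le_sum_of_subset (Finset.erase_subset _ _)
        _ = (n + 1) * d := by simp
    calc (d - 1) * R ≤ d * ((n + 1) * d) := Nat.mul_le_mul (Nat.sub_le _ _) h1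
      _ = (n + 1) * d * d := by ring
      _ ≤ e i₀ := hi₀
  have hsum : e i₀ + (R + d * Q) = (n + 1) * (n + 1) * d * d := by
    rw [← he, Finsupp.degree_eq_sum, ← Finset.add_sum_erase _ _ (Finset.mem_univ i₀), hR, hQ,
      Finset.mul_sum, ← Finset.sum_add_distrib]
    congr 1
    exact Finset.sum_congr rfl fun j _ => Nat.mod_add_div _ _
  obtain ⟨s, hs⟩ : ∃ s, e i₀ = (d - 1) * R + d * s := by
    obtain ⟨t, ht⟩ := Nat.exists_eq_add_of_le hRle
    have h2 : d ∣ t := by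
      have h3 : t + d * (R + Q) = d * ((n + 1) * (n + 1) * d) := by
        have h4 : (d - 1) * R + R = d * R := by
          rw [← Nat.succ_mul, Nat.succ_eq_add_one, Nat.sub_add_cancel hd]
        calc t + d * (R + Q) = ((d - 1) * R + t) + (R + d * Q) := by rw [mul_add, ← h4]; ring
          _ = _ := by rw [← ht, hsum]; ring
      exact (Nat.dvd_add_left (dvd_mul_right d _)).1 (h3 ▸ dvd_mul_right d _)
    obtain ⟨s, rfl⟩ := h2
    exact ⟨s, ht⟩
  have hdec : e = s • pairExp d i₀ i₀ + ∑ j ∈ Finset.univ.erase i₀,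
      ((e j / d) • pairExp d j j + (e j % d) • pairExp d i₀ j) := by
    have h1 : e = ∑ j, Finsupp.single j (e j) := (Finsupp.univ_sum_single e).symm
    conv_lhs => rw [h1, ← Finset.add_sum_erase _ _ (Finset.mem_univ i₀), hs]
    simp only [pairExp_self hd, smul_add, Finset.sum_add_distrib, pairExp,
      Finsupp.smul_single, smul_eq_mul, mul_one]
    have h2 : ∀ j, Finsupp.single j (e j) =
        Finsupp.single j (e j / d * d) + Finsupp.single j (e j % d) := by
      intro j
      rw [← Finsupp.single_add, Nat.div_add_mod']
    have h3 : ∑ j ∈ Finset.univ.erase i₀, Finsupp.single i₀ (e j % d * (d - 1)) =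
        Finsupp.single i₀ ((d - 1) * R) := by
      rw [mul_comm, hR, Finset.sum_mul]
      exact (map_sum (Finsupp.singleAddHom i₀) _ _).symm
    rw [Finset.sum_congr rfl fun j _ => h2 j, Finset.sum_add_distrib, Finsupp.single_add,
      mul_comm d s, h3]
    abel
  rw [hdec]
  exact A.add_mem (A.nsmul_mem (hA _ _) _) (A.sum_mem fun j _ =>
    A.add_mem (A.nsmul_mem (hA _ _) _) (A.nsmul_mem (hA _ _) _))

lemma exists_eq_sum_pairExp {n d k : ℕ} (hd : 1 ≤ d) (hk : k = (n + 1) * (n + 1) * d)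
    {e : Fin (n + 1) →₀ ℕ} (he : e.degree = k * d) :
    ∃ i j : Fin k → Fin (n + 1), e = ∑ r, pairExp d (i r) (j r) := by
  obtain ⟨l, hl, rfl⟩ := AddSubmonoid.exists_list_of_mem_closure
    (mem_closure_pairExp hd (by rw [he, hk]))
  have hdeg : ∀ y ∈ l, y.degree = d := fun y hy => by
    obtain ⟨i, j, rfl⟩ := hl y hy
    exact degree_pairExp hd i j
  have hlen : l.length = k := by
    have h1 : (l.map Finsupp.degree).sum = l.length * d := by
      rw [List.map_congr_left hdeg]; simp
    rw [map_list_sum, h1] at he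
    exact Nat.eq_of_mul_eq_mul_right hd he
  clear hk he
  subst hlen
  choose i j hij using fun r : Fin l.length => hl l[r.1] (List.getElem_mem _)
  refine ⟨i, j, ?_⟩
  rw [← Fin.sum_univ_getElem]
  exact Finset.sum_congr rfl fun r _ => hij r

/-- The normalized functional whose polar form is the monomial `m`. -/
def coeffFun {n : ℕ} (m : Fin (n + 1) →₀ ℕ) : S n →ₗ[ℂ] ℂ :=
  (m.multinomial : ℂ)⁻¹ • lcoeff ℂ m

lemma polar_coeffFun {n d : ℕ} {m : Fin (n + 1) →₀ ℕ} (hm : m.degree = d) :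
    polar d (coeffFun m) = monomial m 1 := by
  classical
  ext m'
  rw [coeff_polar, coeff_monomial]
  by_cases h : m = m'
  · subst h
    simp [coeffFun, hm, mul_inv_cancel₀ (multinomial_ne_zero m)]
  · simp [coeffFun, h, coeff_monomial, Ne.symm h]

section Deform

variable {n : ℕ} (L : S n →ₗ[ℂ] Fin (n + 1) × Fin (n + 1) → ℂ)

/-- The matrix of pairings of a family of functionals with the forms `jac q f`. -/
def pairing (f : S n) : Matrix (Fin (n + 1) × Fin (n + 1)) (Fin (n + 1) × Fin (n + 1)) ℂ :=
  Matrix.of fun p q => L (jac q f) p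

/-- A multiple of `a` corrected by the functionals `L` so as to vanish on `jacPiece f`. -/
def corrected (a : S n →ₗ[ℂ] ℂ) (f : S n) : S n →ₗ[ℂ] ℂ :=
  (pairing L f).det • a - ∑ q, ∑ p,
    (a (jac q f) * (pairing L f).adjugate q p) • (LinearMap.proj p ∘ₗ L)

lemma corrected_apply (a : S n →ₗ[ℂ] ℂ) (f h : S n) : corrected L a f h =
    (pairing L f).det * a h - ∑ q, ∑ p, a (jac q f) * (pairing L f).adjugate q p * L h p := by
  simp [corrected]

lemma corrected_jac (a : S n →ₗ[ℂ] ℂ) (f : S n) (r : Fin (n + 1) × Fin (n + 1)) :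
    corrected L a f (jac r f) = 0 := by
  have h1 : ∀ q, ∑ p, (pairing L f).adjugate q p * L (jac r f) p =
      if q = r then (pairing L f).det else 0 := by
    intro q
    have := congrFun (congrFun (Matrix.adjugate_mul (pairing L f)) q) r
    rw [Matrix.mul_apply, Matrix.smul_apply, Matrix.one_apply, smul_eq_mul, mul_ite, mul_one,
      mul_zero] at this
    exact this
  simp only [corrected_apply, mul_assoc, ← Finset.mul_sum, h1, mul_ite, mul_zero,
    Finset.sum_ite_eq', Finset.mem_univ, if_true]
  ring

lemma corrected_eq_self {a : S n →ₗ[ℂ] ℂ} {f : S n} (hL : pairing L f = 1)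
    (ha : ∀ q, a (jac q f) = 0) : corrected L a f = a := by
  refine LinearMap.ext fun h => ?_
  rw [corrected_apply, hL]
  simp [ha]

lemma isPolyFun_corrected {d : ℕ} (a : S n →ₗ[ℂ] ℂ) (h : S n) :
    IsPolyFun (fun f : homogeneousSubmodule (Fin (n + 1)) ℂ d => corrected L a (f : S n) h) := by
  have hΓ : ∀ p q, IsPolyFun (fun f : homogeneousSubmodule (Fin (n + 1)) ℂ d =>
      pairing L (f : S n) p q) := fun p q =>
    isPolyFun_linear (LinearMap.proj p ∘ₗ L ∘ₗ jac q ∘ₗ (homogeneousSubmodule _ ℂ d).subtype)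
  simp only [corrected_apply]
  exact ((isPolyFun_det hΓ).mul (isPolyFun_const _)).sub (isPolyFun_sum _ fun q =>
    isPolyFun_sum _ fun p => ((isPolyFun_linear (a ∘ₗ jac q ∘ₗ
      (homogeneousSubmodule _ ℂ d).subtype)).mul (isPolyFun_adjugate hΓ _ _)).mul
        (isPolyFun_const _))

end Deform

theorem exists_isPolyFun_powersSpan {n d k : ℕ} (hd : 1 ≤ d) (hk : k = (n + 1) * (n + 1) * d)
    (f₀ : homogeneousSubmodule (Fin (n + 1)) ℂ d)
    (hI : ∀ b : Fin (n + 1) × Fin (n + 1) → ℂ, ∑ q, b q • jac q (f₀ : S n) = 0 → b = 0)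
    (h₀ : ∀ i j q, coeff (pairExp d i j) (jac q (f₀ : S n)) = 0) :
    ∃ φ : homogeneousSubmodule (Fin (n + 1)) ℂ d → ℂ, IsPolyFun φ ∧ φ f₀ ≠ 0 ∧
      ∀ f, φ f ≠ 0 → PowersSpan d k (f : S n) := by
  classical
  obtain ⟨L, hL⟩ := LinearMap.exists_leftInverse_of_injective
    (Fintype.linearCombination ℂ fun q => jac q (f₀ : S n)) (LinearMap.ker_eq_bot'.2 fun b hb =>
      hI b hb)
  have hpair : pairing L (f₀ : S n) = 1 := by
    ext p q
    have h1 := congrFun (LinearMap.congr_fun hL (Pi.single q 1)) p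
    rw [LinearMap.comp_apply, Fintype.linearCombination_apply_single, one_smul] at h1
    rw [pairing, Matrix.of_apply, h1, Matrix.one_apply, LinearMap.id_apply, Pi.single_apply]
  let E := {e // e ∈ expo n (k * d)}
  choose i j hij using fun e : E => exists_eq_sum_pairExp hd hk (mem_expo.1 e.2)
  let P : E → S n → S n := fun e f =>
    ∏ r, polar d (corrected L (coeffFun (pairExp d (i e r) (j e r))) f)
  let N : S n → Matrix E E ℂ := fun f => Matrix.of fun e e' => coeff e'.1 (P e f)
  have hP₀ : ∀ e, P e (f₀ : S n) = monomial e.1 1 := by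
    intro e
    simp only [P]
    rw [hij e, monomial_sum_one]
    refine Finset.prod_congr rfl fun r _ => ?_
    rw [corrected_eq_self L hpair (fun q => by simp [coeffFun, h₀]),
      polar_coeffFun (degree_pairExp hd _ _)]
  refine ⟨fun f => (N (f : S n)).det, isPolyFun_det fun e e' => ?_, ?_, fun f hf => ?_⟩
  · refine isPolyFun_coeff_prod _ (fun r m => ?_) _
    simp only [coeff_polar]
    split_ifs
    · exact (isPolyFun_const _).mul (isPolyFun_corrected L _ _)
    · exact isPolyFun_const _
  · have : N (f₀ : S n) = 1 := by
      ext e e'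
      simp only [N, Matrix.of_apply, hP₀, coeff_monomial, Matrix.one_apply]
      exact if_congr Subtype.ext_iff.symm rfl rfl
    simp only [this, Matrix.det_one]
    exact one_ne_zero
  · intro e he
    have hPe : ∀ e, (P e (f : S n)).IsHomogeneous (k * d) := by
      intro e
      have := IsHomogeneous.prod Finset.univ (fun r => polar d
        (corrected L (coeffFun (pairExp d (i e r) (j e r))) (f : S n))) (fun _ => d)
        fun r _ => isHomogeneous_polar _
      simpa using this
    have h1 : monomial e 1 = ∑ e', (N (f : S n))⁻¹ ⟨e, mem_expo.2 he⟩ e' • P e' (f : S n) := by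
      ext m
      simp only [coeff_sum, coeff_smul, smul_eq_mul]
      by_cases hm : m.degree = k * d
      · have h2 := congrFun (congrFun (Matrix.nonsing_inv_mul (N (f : S n))
          (isUnit_iff_ne_zero.2 hf)) ⟨e, mem_expo.2 he⟩) ⟨m, mem_expo.2 hm⟩
        rw [Matrix.mul_apply, Matrix.one_apply] at h2
        rw [coeff_monomial]
        simp only [Subtype.ext_iff] at h2
        exact h2.symm
      · rw [Finset.sum_eq_zero fun e' _ => by rw [(hPe e').coeff_eq_zero hm, mul_zero],
          coeff_monomial, if_neg]
        rintro rfl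
        exact hm he
    rw [h1]
    refine Submodule.sum_mem _ fun e' _ => Submodule.smul_mem _ _ (Submodule.subset_span ?_)
    exact ⟨_, fun r q => corrected_jac L _ _ q, rfl⟩

/-- first-order Schiffer variations recover the hypersurface.
For `d ≥ 4`, `n ≥ 4` and generic `f`: if `g` defines a smooth hypersurface and some linear
isomorphism `i : R_f^d ≃ R_g^d` maps the set of first-order Schiffer variations
`{x^d mod J_f : x ∈ S¹}` onto `{y^d mod J_g : y ∈ S¹}`, then `X_f ≅ X_g`, i.e.
`g(X) = λ·f(A·X)` for some `A ∈ GL(n+1,ℂ)`, `λ ≠ 0`. -/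
theorem schiffer_variations_recover (n d : ℕ) (hd : 4 ≤ d) (hn : 4 ≤ n) :
    GenericallyHolds (fun f : MvPolynomial.homogeneousSubmodule (Fin (n + 1)) ℂ d =>
      ∀ g : S n, g.IsHomogeneous d → SmoothHyp g →
        ∀ i : Rpiece (f : S n) d ≃ₗ[ℂ] Rpiece g d,
          (∀ z : Rpiece (f : S n) d,
            (∃ x : S n, x.IsHomogeneous 1 ∧
              (z : S n ⧸ jacobianIdeal (f : S n)) =
                Ideal.Quotient.mk (jacobianIdeal (f : S n)) (x ^ d)) ↔
            (∃ y : S n, y.IsHomogeneous 1 ∧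
              ((i z : S n ⧸ jacobianIdeal g)) =
                Ideal.Quotient.mk (jacobianIdeal g) (y ^ d))) →
          ∃ (A : Matrix.GeneralLinearGroup (Fin (n + 1)) ℂ) (lam : ℂ), lam ≠ 0 ∧
            g = lam • substLin (A : Matrix (Fin (n + 1)) (Fin (n + 1)) ℂ) (f : S n)) := by
  have hd1 : 1 ≤ d := by omega
  let f₀ : homogeneousSubmodule (Fin (n + 1)) ℂ d := ⟨fourForm n d, isHomogeneous_fourForm n d⟩
  obtain ⟨φ, hφ, hφ₀, hφ'⟩ := exists_isPolyFun_rigid f₀ (rigid_fourForm hn hd)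
    (jac_fourForm_independent hn hd)
  obtain ⟨ψ, hψ, hψ₀, hψ'⟩ := exists_isPolyFun_powersSpan hd1 rfl f₀
    (jac_fourForm_independent hn hd)
    (fun i j q => coeff_jac_fourForm_of_support q (card_support_pair i j _ _))
  refine ⟨fun f => φ f * ψ f, hφ.mul hψ, ⟨f₀, mul_ne_zero hφ₀ hψ₀⟩,
    fun f hf g hg hsm i hi => ?_⟩
  obtain ⟨h1, h2⟩ := mul_ne_zero_iff.1 hf
  exact recover_of_rigid hd1 (by omega) (Nat.mul_pos (by positivity) hd1) f.2 (hψ' f h2)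
    (hφ' f h1) hg hsm i hi

end
end
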